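/- Let k be an algebraically closed field of characteristic zero. Let X be a nonempty integral scheme that is smooth and quasi-projective over k and algebraically simply connected, i.e., every finite étale morphism from a nonempty connected scheme onto X is an isomorphism. Let M be a nonempty, connected, normal, quasi-projective scheme over k, and let h : M → X be a projective (in particular proper) morphism. Suppose that the closed subset M_h of M consisting of the points of M at which h is not smooth has codimension at least 2 in M. Then the geometric generic fiber of h is connected; that is, if η denotes the generic point of X and κ(η) its residue field (the function field of X), then the base change of M along Spec of an algebraic closure of κ(η) → X is a connected scheme. -/

import Mathlib

open AlgebraicGeometry CategoryTheory CategoryTheory.Limits TopologicalSpace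

noncomputable section

universe u

attribute [local instance] MvPolynomial.gradedAlgebra

/-- Projective `n`-space over `k`, as `Proj` of the standard graded polynomial ring
`k[x₀,…,x_n]`. -/
def ProjectiveSpaceOver (k : Type u) [CommRing k] (n : ℕ) : Scheme.{u} :=
  Proj (MvPolynomial.homogeneousSubmodule (Fin (n + 1)) k)

/-- The structure morphism `ℙⁿ_k ⟶ Spec k`. -/
def projectiveSpaceStruct (k : Type u) [CommRing k] (n : ℕ) :
    ProjectiveSpaceOver k n ⟶ Spec (CommRingCat.of k) :=
  Proj.toSpecZero _ ≫
    Spec.map (CommRingCat.ofHom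
      (algebraMap k (MvPolynomial.homogeneousSubmodule (Fin (n + 1)) k 0)))

/-- A scheme `Z` over `k` (with structure morphism `sZ`) is quasi-projective over `k` if it
admits a locally closed immersion into some projective space `ℙⁿ_k` over `k`. -/
def QuasiProjectiveOver (k : Type u) [CommRing k] {Z : Scheme.{u}}
    (sZ : Z ⟶ Spec (CommRingCat.of k)) : Prop :=
  ∃ (n : ℕ) (ι : Z ⟶ ProjectiveSpaceOver k n),
    IsImmersion ι ∧ ι ≫ projectiveSpaceStruct k n = sZ

/-- A morphism `h : M ⟶ X` of schemes over `k` is projective if it factors as a closed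
immersion into `ℙⁿ_X = ℙⁿ_k ×_{Spec k} X` followed by the projection to `X`. -/
def ProjectiveMorphismOver (k : Type u) [CommRing k] {M X : Scheme.{u}}
    (sX : X ⟶ Spec (CommRingCat.of k)) (h : M ⟶ X) : Prop :=
  ∃ (n : ℕ) (ι : M ⟶ pullback (projectiveSpaceStruct k n) sX),
    IsClosedImmersion ι ∧ ι ≫ pullback.snd (projectiveSpaceStruct k n) sX = h

/-- A scheme is normal if all of its stalks are integrally closed domains. -/
def IsNormalScheme (M : Scheme.{u}) : Prop :=
  ∀ x : M, IsDomain (M.presheaf.stalk x) ∧ IsIntegrallyClosed (M.presheaf.stalk x)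

/-- A scheme `X` is algebraically simply connected if every finite étale morphism from a
nonempty connected scheme onto `X` is an isomorphism. -/
def AlgebraicallySimplyConnected (X : Scheme.{u}) : Prop :=
  ∀ (Z : Scheme.{u}) (f : Z ⟶ X), Nonempty Z → ConnectedSpace Z →
    IsFinite f → IsEtale f → Function.Surjective f.base → IsIso f

/-- A morphism of schemes `h : M ⟶ X` is smooth at a point `x : M` if `h` is smooth on
some open neighbourhood of `x`. -/
def SmoothAtPoint {M X : Scheme.{u}} (h : M ⟶ X) (x : M) : Prop :=
  ∃ U : M.Opens, x ∈ U ∧ IsSmooth (U.ι ≫ h)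

section

open Polynomial TensorProduct IntermediateField

/-- Dual derivations at a maximal ideal of a smooth algebra. -/
theorem exists_dual_derivations {k A : Type*} [Field k] [IsAlgClosed k] [CommRing A] [Algebra k A]
    [Algebra.FiniteType k A] [Algebra.FormallySmooth k A] (m : Ideal A) [m.IsMaximal] :
    ∃ (n : ℕ) (x : Fin n → A) (D : Fin n → Derivation k A A), (∀ i, x i ∈ m) ∧
      ∀ a ∈ m, a - ∑ i, x i * D i a ∈ m ^ 2 := by
  have : IsNoetherianRing A := Algebra.FiniteType.isNoetherianRing k A
  let : Field (A ⧸ m) := Ideal.Quotient.field m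
  have : Module.Finite k (A ⧸ m) := finite_of_finite_type_of_isJacobsonRing k (A ⧸ m)
  have hb : Function.Bijective (algebraMap k (A ⧸ m)) :=
    IsAlgClosed.algebraMap_bijective_of_isIntegral
  let e : k ≃ₐ[k] (A ⧸ m) := AlgEquiv.ofBijective (Algebra.ofId k _) hb
  let σ : A →ₐ[k] k := e.symm.toAlgHom.comp (Ideal.Quotient.mkₐ k m)
  have hσ : ∀ a, a - algebraMap k A (σ a) ∈ m := fun a ↦ by
    rw [← Ideal.Quotient.eq]
    have := e.apply_symm_apply (Ideal.Quotient.mk m a)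
    exact this.symm
  have hσm : ∀ a ∈ m, σ a = 0 := fun a ha ↦ by
    have : Ideal.Quotient.mk m a = 0 := Ideal.Quotient.eq_zero_iff_mem.2 ha
    simp [σ, this]
  let p : A →ₗ[k] m :=
    { toFun := fun a ↦ ⟨a - algebraMap k A (σ a), hσ a⟩
      map_add' := fun a b ↦ by ext; simp; ring
      map_smul' := fun c a ↦ by ext; simp [Algebra.smul_def]; ring }
  let δ : Derivation k A m.Cotangent := Derivation.mk' ((m.toCotangent.restrictScalars k) ∘ₗ p) (by
    intro a b
    simp only [LinearMap.coe_comp, Function.comp_apply, LinearMap.coe_restrictScalars]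
    rw [← map_smul m.toCotangent, ← map_smul m.toCotangent, ← map_add, Ideal.toCotangent_eq]
    have : ((p (a * b) : m) : A) - ((a • p b + b • p a : m) : A) = - ((p a : A) * (p b : A)) := by
      simp [p]; ring
    rw [this, pow_two]
    exact neg_mem (Ideal.mul_mem_mul (p a).2 (p b).2))
  obtain ⟨n, f, hf⟩ := Module.Finite.exists_fin' A m
  obtain ⟨g, hg⟩ := Module.projective_lifting_property (m.toCotangent ∘ₗ f) δ.liftKaehlerDifferential
    (m.toCotangent_surjective.comp hf)
  refine ⟨n, fun i ↦ (f (Pi.single i 1) : A), fun i ↦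
    ((LinearMap.proj i ∘ₗ g).compDer (KaehlerDifferential.D k A)), fun i ↦ (f _).2, fun a ha ↦ ?_⟩
  have h1 := LinearMap.congr_fun hg (KaehlerDifferential.D k A a)
  rw [Derivation.liftKaehlerDifferential_comp_D] at h1
  have h2 : δ a = m.toCotangent ⟨a, ha⟩ := by
    change m.toCotangent (p a) = _
    congr 1; ext; simp [p, hσm a ha]
  rw [h2] at h1
  have h3 := (Ideal.toCotangent_eq _).1 h1.symm
  rw [LinearMap.pi_apply_eq_sum_univ f (g _)] at h3
  have h4 : ∀ i : Fin n, (Pi.single i 1 : Fin n → A) = fun j ↦ if i = j then 1 else 0 := fun i ↦ by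
    ext j; simp [Pi.single_apply, eq_comm]
  simpa [mul_comm, h4] using h3

theorem euler_derivation_pow {k A : Type*} [CommRing k] [CommRing A] [Algebra k A]
    (m : Ideal A) (E : Derivation k A A) (hE : ∀ a ∈ m, a - E a ∈ m ^ 2) (d : ℕ) (f : A)
    (hf : f ∈ m ^ (d + 1)) : ((d + 1 : ℕ) : A) * f - E f ∈ m ^ (d + 2) := by
  induction d generalizing f with
  | zero => simpa using hE f (by simpa using hf)
  | succ d ih =>
    rw [pow_succ] at hf
    induction hf using Submodule.mul_induction_on' with
    | mem_mul_mem a ha b hb =>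
      have h1 : a * (b - E b) ∈ m ^ (d + 1) * m ^ 2 := Ideal.mul_mem_mul ha (hE b hb)
      have h2 : (((d + 1 : ℕ) : A) * a - E a) * b ∈ m ^ (d + 2) * m := Ideal.mul_mem_mul (ih a ha) hb
      rw [← pow_add] at h1
      rw [← pow_succ] at h2
      convert! add_mem h1 h2 using 1
      simp; ring
    | add a _ b _ ha hb =>
      convert! add_mem ha hb using 1
      simp; ring

/-- An element of `m ^ (d + 1)` whose derivatives all lie in `m ^ (d + 1)` lies in `m ^ (d + 2)`. -/
theorem mem_pow_succ_of_derivation_mem_pow {k A : Type*} [Field k] [CharZero k] [IsAlgClosed k]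
    [CommRing A] [Algebra k A]
    [Algebra.FiniteType k A] [Algebra.FormallySmooth k A] (m : Ideal A) [m.IsMaximal]
    (d : ℕ) (f : A) (hf : f ∈ m ^ (d + 1)) (hD : ∀ D : Derivation k A A, D f ∈ m ^ (d + 1)) :
    f ∈ m ^ (d + 2) := by
  obtain ⟨n, x, D, hx, h⟩ := exists_dual_derivations (k := k) m
  let E : Derivation k A A := ∑ i, x i • D i
  have hEapp : ∀ a, E a = ∑ i, x i * D i a := fun a ↦ by
    simp only [E]
    rw [← Derivation.coeFnAddMonoidHom_apply, map_sum, Finset.sum_apply]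
    simp
  have h1 := euler_derivation_pow m E (fun a ha ↦ by rw [hEapp]; exact h a ha) d f hf
  have h2 : E f ∈ m ^ (d + 2) := by
    rw [hEapp]
    refine sum_mem fun i _ ↦ ?_
    rw [pow_succ']
    exact Ideal.mul_mem_mul (hx i) (hD _)
  have h3 : ((d + 1 : ℕ) : A) * f ∈ m ^ (d + 2) := by simpa using add_mem h1 h2
  have h4 := Ideal.mul_mem_left _ (algebraMap k A ((d + 1 : ℕ) : k)⁻¹) h3
  rw [← mul_assoc, ← map_natCast (algebraMap k A), ← map_mul, inv_mul_cancel₀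
    (by exact_mod_cast d.succ_ne_zero), map_one, one_mul] at h4
  exact h4

/-- A nonzero ideal stable under all derivations is the unit ideal. -/
theorem eq_top_of_derivation_stable (k : Type*) {A : Type*} [Field k] [CharZero k] [IsAlgClosed k]
    [CommRing A] [IsDomain A] [Algebra k A]
    [Algebra.FiniteType k A] [Algebra.FormallySmooth k A] (J : Ideal A) (hJ : J ≠ ⊥)
    (hD : ∀ (D : Derivation k A A), ∀ a ∈ J, D a ∈ J) : J = ⊤ := by
  have : IsNoetherianRing A := Algebra.FiniteType.isNoetherianRing k A
  by_contra hJt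
  obtain ⟨m, hm, hJm⟩ := Ideal.exists_le_maximal J hJt
  have key : ∀ d, J ≤ m ^ (d + 1) := by
    intro d
    induction d with
    | zero => simpa using hJm
    | succ d ih =>
      exact fun a ha ↦ mem_pow_succ_of_derivation_mem_pow (k := k) m d a (ih ha)
        fun D ↦ ih (hD D a ha)
  apply hJ
  rw [eq_bot_iff, ← Ideal.iInf_pow_eq_bot_of_isDomain m hm.ne_top]
  exact le_iInf fun i ↦ (key i).trans (Ideal.pow_le_pow_right (by omega))

theorem mem_pow_of_mul_mem_pow {A : Type*} [CommRing A] (m : Ideal A) [hm : m.IsMaximal] {s a : A}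
    (hs : s ∉ m) {d : ℕ} (h : s * a ∈ m ^ d) : a ∈ m ^ d :=
  (Ideal.IsMaximal.mul_mem_pow m h).resolve_left hs

/-- A finite module with a lift of every derivation is flat. -/
theorem flat_of_connection (k : Type*) {A N : Type*} [Field k] [CharZero k] [IsAlgClosed k]
    [CommRing A] [IsDomain A] [Algebra k A]
    [Algebra.FiniteType k A] [Algebra.FormallySmooth k A] [AddCommGroup N] [Module A N]
    [Module.Finite A N]
    (hN : ∀ D : Derivation k A A, ∃ N' : N →+ N, ∀ (a : A) (n : N), N' (a • n) = D a • n + a • N' n) :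
    Module.Flat A N := by
  classical
  have : IsNoetherianRing A := Algebra.FiniteType.isNoetherianRing k A
  refine Module.flat_of_localized_maximal N fun m hm ↦ ?_
  let P : ℕ → Prop := fun r ↦ ∃ t : Finset N, t.card = r ∧ ∃ s ∉ m, ∀ n : N,
    s • n ∈ Submodule.span A (t : Set N)
  have hP : ∃ r, P r := by
    obtain ⟨t, ht⟩ := Module.Finite.fg_top (R := A) (M := N)
    exact ⟨_, t, rfl, 1, fun h ↦ hm.ne_top ((Ideal.eq_top_iff_one _).2 h), fun n ↦ by simp [ht]⟩
  obtain ⟨t, htr, s, hs, hst⟩ := Nat.find_spec hP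
  have hmin : ∀ t' : Finset N, (∃ s ∉ m, ∀ n : N, s • n ∈ Submodule.span A (t' : Set N)) →
      t.card ≤ t'.card := fun t' ht' ↦ htr ▸ Nat.find_min' hP ⟨t', rfl, ht'⟩
  have hrel : ∀ a : N → A, ∑ e ∈ t, a e • e = 0 → ∀ e ∈ t, a e ∈ m := by
    intro a ha e he
    by_contra hae
    refine absurd (hmin (t.erase e) ⟨s * a e, fun h ↦ (hm.isPrime.mem_or_mem h).elim hs hae,
      fun n ↦ ?_⟩) (by simpa using Finset.card_erase_lt_of_mem he)
    have h1 : ∀ x ∈ Submodule.span A (t : Set N),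
        a e • x ∈ Submodule.span A ((t.erase e : Finset N) : Set N) := by
      intro x hx
      induction hx using Submodule.span_induction with
      | zero => simp
      | add x y _ _ hx hy => rw [smul_add]; exact add_mem hx hy
      | smul c x _ hx => rw [smul_comm]; exact Submodule.smul_mem _ _ hx
      | mem x hx =>
        by_cases hxe : x = e
        · subst hxe
          rw [← Finset.add_sum_erase t _ he, add_eq_zero_iff_eq_neg] at ha
          rw [ha]
          exact neg_mem (sum_mem fun y hy ↦ Submodule.smul_mem _ _ (Submodule.subset_span hy))
        · exact Submodule.smul_mem _ _ (Submodule.subset_span (by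
            simpa [hxe] using hx))
    rw [mul_comm, mul_smul]
    exact h1 _ (hst n)
  have hrel' : ∀ d, ∀ a : N → A, ∑ e ∈ t, a e • e = 0 → ∀ e ∈ t, a e ∈ m ^ (d + 1) := by
    intro d
    induction d with
    | zero => simpa using hrel
    | succ d ih =>
      intro a ha e he
      refine mem_pow_succ_of_derivation_mem_pow (k := k) m d (a e) (ih a ha e he) fun D ↦ ?_
      obtain ⟨N', hN'⟩ := hN D
      have hΓ : ∀ e : N, ∃ c : N → A, ∑ e' ∈ t, c e' • e' = s • N' e := fun e ↦ by
        obtain ⟨c, -, hc⟩ := Submodule.mem_span_finset.1 (hst (N' e))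
        exact ⟨c, hc⟩
      choose Γ hΓ using hΓ
      have h0 : ∑ e' ∈ t, (s * D (a e') + ∑ e'' ∈ t, a e'' * Γ e'' e') • e' = 0 := by
        have h1 : s • N' (∑ e ∈ t, a e • e) = 0 := by simp [ha]
        simp only [add_smul, Finset.sum_add_distrib, Finset.sum_smul]
        rw [Finset.sum_comm]
        simp only [mul_smul, ← Finset.smul_sum, hΓ]
        rw [← h1, map_sum, Finset.smul_sum, Finset.smul_sum, ← Finset.sum_add_distrib]
        refine Finset.sum_congr rfl fun e _ ↦ ?_
        rw [hN', smul_add, smul_comm s (a e)]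
      have h2 := ih _ h0 e he
      refine mem_pow_of_mul_mem_pow m hs ((Ideal.add_mem_iff_left _ ?_).1 h2)
      exact sum_mem fun e'' he'' ↦ Ideal.mul_mem_right _ _ (ih a ha e'' he'')
  have hli₀ : LinearIndepOn A id (t : Set N) := by
    refine linearIndepOn_finset_iff.2 fun a ha e he ↦ ?_
    have : a e ∈ ⨅ i, m ^ i := by
      rw [Submodule.mem_iInf]
      exact fun i ↦ Ideal.pow_le_pow_right (by omega) (hrel' i a ha e he)
    rwa [Ideal.iInf_pow_eq_bot_of_isDomain m hm.ne_top] at this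
  have hli : LinearIndependent A (fun e : t ↦ (e : N)) := hli₀
  let Am := Localization m.primeCompl
  let f := LocalizedModule.mkLinearMap m.primeCompl N
  have hli' : LinearIndependent Am (f ∘ fun e : t ↦ (e : N)) :=
    LinearIndependent.of_isLocalizedModule Am m.primeCompl f hli
  have hspan : ⊤ ≤ Submodule.span Am (Set.range (f ∘ fun e : t ↦ (e : N))) := by
    rintro y -
    obtain ⟨⟨n, u⟩, hy⟩ := IsLocalizedModule.surj m.primeCompl f y
    have h1 : ∀ x ∈ Submodule.span A (t : Set N),
        f x ∈ Submodule.span Am (Set.range (f ∘ fun e : t ↦ (e : N))) := by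
      intro x hx
      induction hx using Submodule.span_induction with
      | zero => simp
      | add x y _ _ hx hy => rw [map_add]; exact add_mem hx hy
      | smul c x _ hx =>
        rw [map_smul, ← algebraMap_smul Am]; exact Submodule.smul_mem _ _ hx
      | mem x hx => exact Submodule.subset_span ⟨⟨x, hx⟩, rfl⟩
    have hu : IsUnit (algebraMap A Am (s * u)) :=
      IsLocalization.map_units Am (⟨s * u, m.primeCompl.mul_mem hs u.2⟩ : m.primeCompl)
    rw [← Submodule.smul_mem_iff_of_isUnit _ hu, algebraMap_smul, mul_smul]
    have : (u : A) • y = f n := hy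
    rw [this, ← map_smul]
    exact h1 _ (hst n)
  have : Module.Free Am (LocalizedModule m.primeCompl N) :=
    Module.Free.of_basis (Module.Basis.mk hli' hspan)
  exact Module.Flat.trans A Am _

/-- A derivation lifted to `B` induces one on the tensor square of `B`. -/
theorem exists_tensor_derivation {A B : Type*} [CommRing A] [CommRing B] [Algebra A B]
    (D : A → A) (D' : B →+ B) (hl : ∀ b c, D' (b * c) = b * D' c + c * D' b)
    (hD' : ∀ a, D' (algebraMap A B a) = algebraMap A B (D a)) :
    ∃ T : B ⊗[A] B →+ B ⊗[A] B, (∀ b c, T (b ⊗ₜ c) = D' b ⊗ₜ c + b ⊗ₜ D' c) ∧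
      (∀ x y, T (x * y) = x * T y + y * T x) := by
  have hs : ∀ (r : A) (b : B), D' (r • b) = r • D' b + D r • b := fun r b ↦ by
    rw [Algebra.smul_def, hl, hD', Algebra.smul_def, Algebra.smul_def]; ring
  let f : B →+ B →+ B ⊗[A] B :=
    { toFun := fun b ↦
        { toFun := fun c ↦ D' b ⊗ₜ c + b ⊗ₜ D' c
          map_zero' := by simp
          map_add' := fun c d ↦ by simp [tmul_add]; abel }
      map_zero' := by ext; simp
      map_add' := fun c d ↦ by ext; simp [add_tmul]; abel }
  let T : B ⊗[A] B →+ B ⊗[A] B := TensorProduct.liftAddHom f fun r m n ↦ by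
    change D' (r • m) ⊗ₜ[A] n + (r • m) ⊗ₜ[A] D' n = D' m ⊗ₜ[A] (r • n) + m ⊗ₜ[A] D' (r • n)
    simp only [hs, add_tmul, tmul_add, tmul_smul, smul_tmul']
    abel
  have hT : ∀ b c, T (b ⊗ₜ c) = D' b ⊗ₜ c + b ⊗ₜ D' c := fun b c ↦ rfl
  refine ⟨T, hT, fun x y ↦ ?_⟩
  induction x using TensorProduct.induction_on with
  | zero => simp
  | add x₁ x₂ h₁ h₂ => simp only [add_mul, map_add, h₁, h₂, mul_add]; abel
  | tmul b c =>
    induction y using TensorProduct.induction_on with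
    | zero => simp
    | add x₁ x₂ h₁ h₂ => simp only [add_mul, map_add, h₁, h₂, mul_add]; abel
    | tmul b' c' =>
      simp only [Algebra.TensorProduct.tmul_mul_tmul, hT, hl, mul_add, tmul_add, add_tmul]
      rw [mul_comm b' (D' b), mul_comm c' (D' c), mul_comm b' b, mul_comm c' c]
      abel

theorem exists_derivative_ne_zero {A B : Type*} [CommRing A] [CharZero A] [CommRing B] [IsDomain B]
    [Algebra A B] (hinj : Function.Injective (algebraMap A B)) (b : B) (hb : IsAlgebraic A b) :
    ∃ p : Polynomial A, Polynomial.aeval b p = 0 ∧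
      Polynomial.aeval b (Polynomial.derivative p) ≠ 0 := by
  have : IsDomain A := hinj.isDomain
  let P : ℕ → Prop := fun n ↦ ∃ p : Polynomial A, p ≠ 0 ∧ Polynomial.aeval b p = 0 ∧ p.natDegree = n
  have hP : ∃ n, P n := by
    obtain ⟨p, hp, hpb⟩ := hb
    exact ⟨_, p, hp, hpb, rfl⟩
  classical
  obtain ⟨p, hp0, hpb, hpn⟩ := Nat.find_spec hP
  refine ⟨p, hpb, fun h ↦ ?_⟩
  have hd : p.natDegree ≠ 0 := by
    intro h0
    rw [Polynomial.eq_C_of_natDegree_eq_zero h0, Polynomial.aeval_C] at hpb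
    apply hp0
    rw [Polynomial.eq_C_of_natDegree_eq_zero h0, (injective_iff_map_eq_zero _).1 hinj _ hpb, map_zero]
  have hd' : Polynomial.derivative p ≠ 0 := fun h0 ↦
    hd (Polynomial.derivative_eq_zero.1 h0)
  exact Nat.find_min hP (hpn ▸ Polynomial.natDegree_derivative_lt hd) ⟨_, hd', h, rfl⟩

theorem etale_of_derivations_extend (k : Type*) {A B : Type*} [Field k] [CharZero k] [IsAlgClosed k]
    [CommRing A] [IsDomain A] [Algebra k A]
    [Algebra.FiniteType k A] [Algebra.FormallySmooth k A] [CommRing B] [IsDomain B] [Algebra A B]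
    [Module.Finite A B] (hinj : Function.Injective (algebraMap A B))
    (hD : ∀ D : Derivation k A A, ∃ D' : B →+ B, (∀ b c, D' (b * c) = b * D' c + c * D' b) ∧
      ∀ a, D' (algebraMap A B a) = algebraMap A B (D a)) :
    Algebra.Etale A B := by
  have : IsNoetherianRing A := Algebra.FiniteType.isNoetherianRing k A
  have : CharZero A := charZero_of_injective_algebraMap (algebraMap k A).injective
  have : Algebra.FinitePresentation A B :=
    Algebra.FinitePresentation.of_finiteType.1 inferInstance
  have : Module.Flat A B := by
    refine flat_of_connection k fun D ↦ ?_
    obtain ⟨D', hl, hD'⟩ := hD D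
    exact ⟨D', fun a n ↦ by rw [Algebra.smul_def, hl, hD', Algebra.smul_def, Algebra.smul_def]; ring⟩
  have : Module.Finite A Ω[B⁄A] := Module.Finite.trans B _
  have htor : Module.IsTorsion A Ω[B⁄A] := by
    suffices h : ∀ x : Ω[B⁄A], ∃ a : A, a ≠ 0 ∧ a • x = 0 by
      intro x
      obtain ⟨a, ha, hx⟩ := h x
      exact ⟨⟨a, mem_nonZeroDivisors_of_ne_zero ha⟩, hx⟩
    intro x
    have hx : x ∈ Submodule.span B (Set.range (KaehlerDifferential.D A B)) := by
      rw [KaehlerDifferential.span_range_derivation]; trivial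
    induction hx using Submodule.span_induction with
    | zero => exact ⟨1, one_ne_zero, by simp⟩
    | add x y _ _ hx hy =>
      obtain ⟨a, ha, hx⟩ := hx
      obtain ⟨b, hb, hy⟩ := hy
      refine ⟨a * b, mul_ne_zero ha hb, ?_⟩
      rw [smul_add, mul_smul, mul_smul, hy, smul_comm, hx]; simp
    | smul c x _ hx =>
      obtain ⟨a, ha, hx⟩ := hx
      exact ⟨a, ha, by rw [smul_comm, hx, smul_zero]⟩
    | mem x hx =>
      obtain ⟨b, rfl⟩ := hx
      obtain ⟨p, hp, hp'⟩ := exists_derivative_ne_zero hinj b (Algebra.IsAlgebraic.isAlgebraic b)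
      have h1 := (KaehlerDifferential.D A B).map_aeval p b
      rw [hp, map_zero] at h1
      have h2 := Ideal.comap_ne_bot_of_integral_mem (R := A)
        (I := Ideal.span {Polynomial.aeval b (Polynomial.derivative p)}) hp'
        (Ideal.mem_span_singleton_self _) (Algebra.IsIntegral.isIntegral _)
      obtain ⟨a, ha, ha0⟩ := Submodule.exists_mem_ne_zero_of_ne_bot h2
      refine ⟨a, ha0, ?_⟩
      obtain ⟨c, hc⟩ := Ideal.mem_span_singleton'.1 (Ideal.mem_comap.1 ha)
      rw [← algebraMap_smul B, ← hc, mul_smul, ← h1, smul_zero]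
  have hann : Module.annihilator A Ω[B⁄A] = ⊤ := by
    refine eq_top_of_derivation_stable k _ ?_ ?_
    · obtain ⟨a, ha, ha'⟩ := Submodule.annihilator_top_inter_nonZeroDivisors htor
      rw [Submodule.annihilator_top] at ha
      intro h
      rw [h] at ha
      exact nonZeroDivisors.ne_zero ha' ha
    · have hiff : ∀ a : A, a ∈ Module.annihilator A Ω[B⁄A] ↔
          ∀ x ∈ KaehlerDifferential.ideal A B, a • x ∈ KaehlerDifferential.ideal A B ^ 2 := by
        intro a
        rw [Module.mem_annihilator]
        have h0 : ∀ x : KaehlerDifferential.ideal A B,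
            a • (KaehlerDifferential.ideal A B).toCotangent x = 0 ↔
              a • (x : B ⊗[A] B) ∈ KaehlerDifferential.ideal A B ^ 2 := fun x ↦ by
          rw [← LinearMap.map_smul_of_tower, Ideal.toCotangent_eq_zero]
          rfl
        constructor
        · intro h x hx
          exact (h0 ⟨x, hx⟩).1 (h _)
        · intro h m
          obtain ⟨x, rfl⟩ := (KaehlerDifferential.ideal A B).toCotangent_surjective m
          exact (h0 x).2 (h x x.2)
      intro D a ha
      rw [hiff] at ha ⊢
      obtain ⟨D', hl, hD'⟩ := hD D
      obtain ⟨T, hT, hTl⟩ := exists_tensor_derivation D D' hl hD'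
      have hTI : ∀ x, Algebra.TensorProduct.lmul' A (T x) =
          D' (Algebra.TensorProduct.lmul' (S := B) A x) := by
        intro x
        induction x using TensorProduct.induction_on with
        | zero => simp
        | add x y hx hy => simp [hx, hy]
        | tmul b c => simp [hT, hl]; ring
      have hI : ∀ x ∈ KaehlerDifferential.ideal A B, T x ∈ KaehlerDifferential.ideal A B := by
        intro x hx
        have hx : Algebra.TensorProduct.lmul' (S := B) A x = 0 := hx
        change Algebra.TensorProduct.lmul' (S := B) A (T x) = 0
        rw [hTI, hx, map_zero]
      have hI2 : ∀ x ∈ KaehlerDifferential.ideal A B ^ 2,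
          T x ∈ KaehlerDifferential.ideal A B ^ 2 := by
        intro x hx
        rw [pow_two] at hx ⊢
        induction hx using Submodule.mul_induction_on' with
        | mem_mul_mem x hx y hy =>
          rw [hTl]
          exact add_mem (Ideal.mul_mem_mul hx (hI y hy)) (Ideal.mul_mem_mul hy (hI x hx))
        | add x _ y _ hx hy => rw [map_add]; exact add_mem hx hy
      intro x hx
      have h1 := hI2 _ (ha x hx)
      have h2 : T (algebraMap A (B ⊗[A] B) a) = algebraMap A (B ⊗[A] B) (D a) := by
        have h1 : D' 1 = 0 := by
          have := hl 1 1
          simpa using this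
        rw [Algebra.TensorProduct.algebraMap_apply, hT, hD', h1]
        simp
      rw [Algebra.smul_def, hTl, h2] at h1
      have h3 := ha _ (hI x hx)
      rw [Algebra.smul_def] at h3 ⊢
      rw [mul_comm]
      exact (Ideal.add_mem_iff_right _ h3).1 h1
  have : Algebra.FormallyUnramified A B := by
    refine ⟨⟨fun x y ↦ ?_⟩⟩
    have h : (1 : A) ∈ Module.annihilator A Ω[B⁄A] := by rw [hann]; trivial
    rw [Module.mem_annihilator] at h
    rw [← one_smul A x, ← one_smul A y, h, h]
  exact Algebra.Etale.of_formallyUnramified_of_flat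

theorem FormallySmooth.exists_ringHom_lift {A C E : Type*} [CommRing A] [CommRing C] [Algebra A C]
    [Algebra.FormallySmooth A C] [CommRing E] (g : E →+* C) (hg : Function.Surjective g)
    (hg' : IsNilpotent (RingHom.ker g)) (φ : A →+* E) (hφ : ∀ a, g (φ a) = algebraMap A C a) :
    ∃ ψ : C →+* E, (∀ a, ψ (algebraMap A C a) = φ a) ∧ ∀ c, g (ψ c) = c := by
  let _ : Algebra A E := φ.toAlgebra
  let g' : E →ₐ[A] C := { g with commutes' := hφ }
  refine ⟨(Algebra.FormallySmooth.liftOfSurjective (AlgHom.id A C) g' hg hg' : C →+* E),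
    fun a ↦ ?_, fun c ↦ ?_⟩
  · exact (Algebra.FormallySmooth.liftOfSurjective (AlgHom.id A C) g' hg hg').commutes a
  · exact Algebra.FormallySmooth.liftOfSurjective_apply (AlgHom.id A C) g' hg hg' c

theorem FormallySmooth.exists_derivation_extends {k A C : Type*} [CommRing k] [CommRing A]
    [Algebra k A] [CommRing C] [Algebra A C] [Algebra.FormallySmooth A C] (D : Derivation k A A) :
    ∃ D' : C →+ C, (∀ b c, D' (b * c) = b * D' c + c * D' b) ∧
      ∀ a, D' (algebraMap A C a) = algebraMap A C (D a) := by
  let g : TrivSqZeroExt C C →+* C := (TrivSqZeroExt.fstHom C C C : _ →+* C)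
  have hgf : ∀ x, g x = x.fst := fun _ ↦ rfl
  have hg : Function.Surjective g := fun c ↦ ⟨TrivSqZeroExt.inl c, rfl⟩
  have hker : IsNilpotent (RingHom.ker g) := by
    refine ⟨2, ?_⟩
    rw [sq (RingHom.ker g), Ideal.zero_eq_bot, eq_bot_iff, Ideal.mul_le]
    intro r hr s hs
    rw [RingHom.mem_ker, hgf] at hr hs
    rw [Ideal.mem_bot]
    ext <;> simp [hr, hs]
  let φ : A →+* TrivSqZeroExt C C :=
    { toFun := fun a ↦ TrivSqZeroExt.inl (algebraMap A C a) + TrivSqZeroExt.inr (algebraMap A C (D a))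
      map_one' := by ext <;> simp
      map_zero' := by ext <;> simp
      map_mul' := fun a b ↦ TrivSqZeroExt.ext (by simp) (by
        simp only [TrivSqZeroExt.snd_add, TrivSqZeroExt.snd_mul, TrivSqZeroExt.snd_inl,
          TrivSqZeroExt.snd_inr, TrivSqZeroExt.fst_add, TrivSqZeroExt.fst_inl,
          TrivSqZeroExt.fst_inr, Derivation.leibniz, map_add, map_mul, smul_eq_mul,
          MulOpposite.smul_eq_mul_unop, MulOpposite.unop_op]
        ring)
      map_add' := fun a b ↦ by ext <;> simp [Algebra.smul_def] }
  obtain ⟨ψ, h1, h2⟩ := exists_ringHom_lift g hg hker φ fun a ↦ by simp [hgf, φ]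
  refine ⟨(TrivSqZeroExt.sndHom C C : _ →+ C).comp ψ.toAddMonoidHom, fun b c ↦ ?_, fun a ↦ ?_⟩
  · have hb := h2 b
    have hc := h2 c
    rw [hgf] at hb hc
    change (ψ (b * c)).snd = b * (ψ c).snd + c * (ψ b).snd
    rw [map_mul, TrivSqZeroExt.snd_mul, hb, hc]; simp [mul_comm]
  · change (ψ (algebraMap A C a)).snd = _
    rw [h1]
    change TrivSqZeroExt.snd (TrivSqZeroExt.inl (algebraMap A C a) +
      TrivSqZeroExt.inr (algebraMap A C (D a))) = _
    rw [TrivSqZeroExt.snd_add, TrivSqZeroExt.snd_inl, TrivSqZeroExt.snd_inr, zero_add]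

/-- Apply a derivation to the coefficients of a polynomial. -/
noncomputable def Polynomial.mapCoeffDerivation {k A : Type*} [CommRing k] [CommRing A] [Algebra k A]
    (D : Derivation k A A) (p : A[X]) : A[X] := p.sum fun n a ↦ C (D a) * X ^ n

theorem derivation_aeval {k A C : Type*} [CommRing k] [CommRing A] [Algebra k A]
    [CommRing C] [Algebra A C] (D : Derivation k A A) (D' : C →+ C)
    (hl : ∀ b c, D' (b * c) = b * D' c + c * D' b)
    (hD' : ∀ a, D' (algebraMap A C a) = algebraMap A C (D a)) (p : A[X]) (b : C) :
    D' (aeval b p) = aeval b (Polynomial.mapCoeffDerivation D p) +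
      aeval b (derivative p) * D' b := by
  have hadd : ∀ p q : A[X], Polynomial.mapCoeffDerivation D (p + q) =
      Polynomial.mapCoeffDerivation D p + Polynomial.mapCoeffDerivation D q := fun p q ↦
    Polynomial.sum_add_index p q _ (by simp) (by simp [add_mul])
  have hpow : ∀ n : ℕ, D' (b ^ n) = n * b ^ (n - 1) * D' b := by
    have h1 : D' 1 = 0 := by
      have := hD' 1
      simpa using this
    intro n
    induction n with
    | zero => simp [h1]
    | succ n ih =>
      rw [pow_succ, hl, ih]
      rcases n with _ | n
      · simp
      · simp only [Nat.cast_add, Nat.cast_one, Nat.add_sub_cancel]; ring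
  induction p using Polynomial.induction_on' with
  | add p q hp hq => simp only [map_add, hp, hq, hadd, add_mul]; ring
  | monomial n a =>
    rw [Polynomial.mapCoeffDerivation, Polynomial.sum_monomial_index _ _ (by simp),
      aeval_monomial, hl, hD', hpow, derivative_monomial, aeval_monomial]
    simp; ring

/-- Algebraic Hartogs lemma for integrally closed Noetherian domains. -/
theorem IsIntegrallyClosed.mem_range_of_height_le_one {C L : Type*} [CommRing C] [IsDomain C]
    [IsNoetherianRing C] [IsIntegrallyClosed C] [Field L] [Algebra C L] [IsFractionRing C L] (x : L)
    (h : ∀ p : Ideal C, p.IsPrime → p.height ≤ 1 →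
      ∃ s ∉ p, algebraMap C L s * x ∈ (algebraMap C L).range) :
    x ∈ (algebraMap C L).range := by
  let N : Submodule C L := LinearMap.range (Algebra.linearMap C L)
  have hN : ∀ y, y ∈ N ↔ y ∈ (algebraMap C L).range := fun y ↦ Iff.rfl
  by_contra hx
  obtain ⟨p, hp, hxp⟩ := exists_le_isAssociatedPrime_of_isNoetherianRing C (N.mkQ x) (by
    rwa [ne_eq, Submodule.mkQ_apply, Submodule.Quotient.mk_eq_zero])
  rw [isAssociatedPrime_iff] at hp
  obtain ⟨hp, y', hy⟩ := hp
  obtain ⟨y, rfl⟩ := N.mkQ_surjective y'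
  have hy : ∀ c, c ∈ p ↔ algebraMap C L c * y ∈ N := fun c ↦ by
    rw [hy, Submodule.mem_colon_singleton, ← map_smul, Submodule.mem_bot, Submodule.mkQ_apply,
      Submodule.Quotient.mk_eq_zero, Algebra.smul_def]
  have hxp : ∀ c, algebraMap C L c * x ∈ N → c ∈ p := fun c hc ↦ hxp (by
    rwa [Submodule.mem_colon_singleton, ← map_smul, Submodule.mem_bot, Submodule.mkQ_apply,
      Submodule.Quotient.mk_eq_zero, Algebra.smul_def])
  have hht : ¬ p.height ≤ 1 := fun hh ↦ by
    obtain ⟨s, hs, hs'⟩ := h p hp hh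
    exact hs (hxp s hs')
  have hinj := IsFractionRing.injective C L
  by_cases hJ : ∃ c ∈ p, ∃ t ∉ p, algebraMap C L c * y = algebraMap C L t
  · obtain ⟨c, hc, t, ht, hct⟩ := hJ
    apply hht
    refine Ideal.height_le_one_of_isPrincipal_of_mem_minimalPrimes (Ideal.span {c}) p
      ⟨⟨hp, by simpa [Ideal.span_le] using hc⟩, fun q hq hqp d hd ↦ ?_⟩
    obtain ⟨e, he⟩ := (hy d).1 hd
    rw [Algebra.linearMap_apply] at he
    have h1 : d * t = c * e := hinj (by rw [map_mul, map_mul, ← hct, he]; ring)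
    have h2 : d * t ∈ q := h1 ▸ q.mul_mem_right _ (hq.2 (Ideal.mem_span_singleton_self c))
    exact (hq.1.mem_or_mem h2).resolve_right fun h3 ↦ ht (hqp h3)
  · push Not at hJ
    have hp0 : p ≠ ⊥ := by
      rintro rfl
      simp at hht
    have : IsIntegral C y := by
      refine isIntegral_of_smul_mem_submodule (M := L) (Submodule.map (Algebra.linearMap C L) p) ?_ ?_ y ?_
      · refine fun h0 ↦ hp0 (eq_bot_iff.2 fun c hc ↦ ?_)
        have h1 := Submodule.mem_map_of_mem (f := Algebra.linearMap C L) hc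
        rw [h0, Submodule.mem_bot, Algebra.linearMap_apply] at h1
        exact hinj (h1.trans (map_zero _).symm)
      · exact Submodule.FG.map _ (IsNoetherian.noetherian p)
      · rintro _ ⟨c, hc, rfl⟩
        obtain ⟨e, he⟩ := (hy c).1 hc
        rw [Algebra.linearMap_apply] at he
        refine ⟨e, ?_, ?_⟩
        · by_contra hep
          exact hJ c hc e hep he.symm
        · simp [he, mul_comm]
    obtain ⟨e, he⟩ := IsIntegrallyClosed.isIntegral_iff.1 this
    apply hp.ne_top
    rw [Ideal.eq_top_iff_one, hy]
    exact ⟨e, by simp [he]⟩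

theorem finite_integralClosure_of_finiteType (k A K L : Type*) [Field k] [CharZero k] [CommRing A]
    [IsDomain A] [Algebra k A] [Algebra.FiniteType k A] [Field K] [Algebra A K] [IsFractionRing A K]
    [Field L] [Algebra K L] [Algebra A L] [IsScalarTower A K L] [FiniteDimensional K L] :
    Module.Finite A (integralClosure A L) := by
  obtain ⟨s, g, hg, hfin⟩ := exists_finite_inj_algHom_of_fg k A
  let P := MvPolynomial (Fin s) k
  let _ : Algebra P A := g.toRingHom.toAlgebra
  have hPA : Module.Finite P A := hfin
  have hinj : Function.Injective (algebraMap P A) := hg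
  let _ : Algebra P K := ((algebraMap A K).comp (algebraMap P A)).toAlgebra
  have : IsScalarTower P A K := .of_algebraMap_eq fun _ ↦ rfl
  let _ : Algebra P L := ((algebraMap A L).comp (algebraMap P A)).toAlgebra
  have : IsScalarTower P A L := .of_algebraMap_eq fun _ ↦ rfl
  have hinjK : Function.Injective (algebraMap P K) := by
    rw [IsScalarTower.algebraMap_eq P A K]
    exact (IsFractionRing.injective A K).comp hinj
  have : FaithfulSMul P K := (faithfulSMul_iff_algebraMap_injective P K).2 hinjK
  have : FaithfulSMul P A := (faithfulSMul_iff_algebraMap_injective P A).2 hinj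
  let Q := FractionRing P
  let _ : Algebra Q K := FractionRing.liftAlgebra P K
  have : IsScalarTower P Q K := FractionRing.isScalarTower_liftAlgebra P K
  have : IsLocalization (Algebra.algebraMapSubmonoid A (nonZeroDivisors P)) K :=
    inferInstance
  have : FiniteDimensional Q K := .of_isLocalization P A (nonZeroDivisors P)
  let _ : Algebra Q L := ((algebraMap K L).comp (algebraMap Q K)).toAlgebra
  have : IsScalarTower Q K L := .of_algebraMap_eq fun _ ↦ rfl
  have : FiniteDimensional Q L := .trans Q K L
  have : CharZero P := charZero_of_injective_algebraMap (algebraMap k P).injective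
  have : CharZero Q := charZero_of_injective_algebraMap (IsFractionRing.injective P Q)
  have : IsScalarTower P Q L := .of_algebraMap_eq fun x ↦ by
    change algebraMap A L (algebraMap P A x) = algebraMap K L (algebraMap Q K (algebraMap P Q x))
    rw [← IsScalarTower.algebraMap_apply P Q K, IsScalarTower.algebraMap_apply P A K,
      ← IsScalarTower.algebraMap_apply A K L]
  let B := integralClosure A L
  have : IsIntegralClosure B P L :=
    { algebraMap_injective := Subtype.val_injective
      isIntegral_iff := fun {x} ↦ by
        constructor
        · intro hx
          exact ⟨⟨x, hx.tower_top⟩, rfl⟩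
        · rintro ⟨y, rfl⟩
          exact isIntegral_trans (R := P) (A := A) _ y.2 }
  have : Module.Finite P B := IsIntegralClosure.finite P Q L B
  exact Module.Finite.of_restrictScalars_finite P A B


theorem exists_common_primitive_element {K E : Type*} [Field K] [CharZero K] [Field E] [Algebra K E]
    [Algebra.IsAlgebraic K E] (x y : E) : ∃ (z : E) (f g : K[X]), aeval z f = x ∧ aeval z g = y := by
  let F : IntermediateField K E := adjoin K {x, y}
  have : FiniteDimensional K F := finiteDimensional_adjoin fun z _ ↦ Algebra.IsIntegral.isIntegral z
  obtain ⟨w, hw⟩ := Field.exists_primitive_element K F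
  have hex : ∀ u : F, ∃ f : K[X], aeval (w : E) f = u := by
    intro u
    have hu : u ∈ K⟮w⟯.toSubalgebra := by rw [hw]; trivial
    rw [adjoin_simple_toSubalgebra_of_isAlgebraic (Algebra.IsAlgebraic.isAlgebraic w),
      Algebra.adjoin_singleton_eq_range_aeval] at hu
    obtain ⟨f, hf⟩ := hu
    refine ⟨f, ?_⟩
    rw [← hf]
    exact (aeval_algHom_apply F.val w f)
  obtain ⟨f, hf⟩ := hex ⟨x, subset_adjoin K _ (by simp)⟩
  obtain ⟨g, hg⟩ := hex ⟨y, subset_adjoin K _ (by simp)⟩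
  exact ⟨w, f, g, hf, hg⟩

theorem isDomain_tensorProduct_of_algebraicallyClosedIn {K L E : Type*} [Field K] [CharZero K]
    [Field L] [Algebra K L] [Field E] [Algebra K E] [Algebra.IsAlgebraic K E]
    (h : ∀ x : L, IsIntegral K x → x ∈ (algebraMap K L).range) : IsDomain (L ⊗[K] E) := by
  let Ω := AlgebraicClosure L
  let φ : E →ₐ[K] Ω := IsAlgClosed.lift
  let ψ : L ⊗[K] E →ₐ[L] Ω := Algebra.TensorProduct.lift (Algebra.ofId L Ω) φ fun _ _ ↦ .all _ _
  have hψ : ∀ e, ψ (1 ⊗ₜ e) = φ e := fun e ↦ by simp [ψ]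
  have hpoly : ∀ z : L ⊗[K] E, ∃ (e : E) (P : L[X]), aeval (1 ⊗ₜ[K] e) P = z := by
    intro z
    induction z using TensorProduct.induction_on with
    | zero => exact ⟨0, 0, by simp⟩
    | tmul l e => exact ⟨e, C l * X, by simp [Algebra.TensorProduct.algebraMap_apply]⟩
    | add z₁ z₂ h₁ h₂ =>
      obtain ⟨e₁, P₁, rfl⟩ := h₁
      obtain ⟨e₂, P₂, rfl⟩ := h₂
      obtain ⟨e, f₁, f₂, rfl, rfl⟩ := exists_common_primitive_element (K := K) e₁ e₂
      have hf : ∀ f : K[X], aeval ((1 : L) ⊗ₜ[K] e) (f.map (algebraMap K L)) =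
          1 ⊗ₜ[K] aeval e f := fun f ↦ by
        rw [aeval_map_algebraMap]
        exact aeval_algHom_apply (Algebra.TensorProduct.includeRight : E →ₐ[K] L ⊗[K] E) e f
      exact ⟨e, P₁.comp (f₁.map (algebraMap K L)) + P₂.comp (f₂.map (algebraMap K L)), by
        rw [map_add, aeval_comp, aeval_comp, hf, hf]⟩
  have hinj : Function.Injective ψ := by
    rw [injective_iff_map_eq_zero]
    intro z hz
    obtain ⟨e, P, rfl⟩ := hpoly z
    rw [← aeval_algHom_apply, hψ] at hz
    have he : IsIntegral K e := Algebra.IsIntegral.isIntegral e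
    have h0 : aeval (φ e) ((minpoly K e).map (algebraMap K L)) = 0 := by
      rw [aeval_map_algebraMap, aeval_algHom_apply, minpoly.aeval, map_zero]
    have hφe : IsIntegral L (φ e) := (he.map φ).tower_top
    obtain ⟨g, hg⟩ : ∃ g : K[X], g.map (algebraMap K L) = minpoly L (φ e) := by
      have := integralClosure.mem_lifts_of_monic_of_dvd_map L (minpoly.monic he)
        (minpoly.monic hφe) (minpoly.dvd L _ h0)
      rw [lifts_iff_coeff_lifts] at this
      rw [← mem_lifts, lifts_iff_coeff_lifts]
      intro n
      obtain ⟨c, hc⟩ := this n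
      rw [← hc]
      exact h _ c.2
    have hge : aeval e g = 0 := by
      apply (φ : E →+* Ω).injective
      change φ (aeval e g) = φ 0
      rw [← aeval_algHom_apply, ← aeval_map_algebraMap L, hg, minpoly.aeval, map_zero]
    obtain ⟨Q, rfl⟩ := minpoly.dvd L _ hz
    rw [map_mul, ← hg, aeval_map_algebraMap]
    have := aeval_algHom_apply (Algebra.TensorProduct.includeRight : E →ₐ[K] L ⊗[K] E) e g
    rw [hge, map_zero] at this
    exact (congrArg (· * _) this).trans (zero_mul _)
  exact hinj.isDomain ψ.toRingHom

theorem derivation_mem_range_of_formallySmooth {k A C L : Type*} [CommRing k] [CommRing A]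
    [CharZero A] [Algebra k A] [CommRing C] [Algebra A C] [Algebra.FormallySmooth A C] [Field L]
    [Algebra A L] [Algebra C L] [IsScalarTower A C L] (hinj : Function.Injective (algebraMap A L))
    (D : Derivation k A A) (D' : L →+ L)
    (hl : ∀ b c, D' (b * c) = b * D' c + c * D' b)
    (hD' : ∀ a, D' (algebraMap A L a) = algebraMap A L (D a)) (b : C)
    (hb : IsAlgebraic A (algebraMap C L b)) (hCL : Function.Injective (algebraMap C L)) :
    D' (algebraMap C L b) ∈ (algebraMap C L).range := by
  obtain ⟨p, hp, hp'⟩ := exists_derivative_ne_zero hinj _ hb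
  obtain ⟨DC, hlC, hDC⟩ := FormallySmooth.exists_derivation_extends (C := C) D
  refine ⟨DC b, ?_⟩
  have h1 := derivation_aeval D D' hl hD' p (algebraMap C L b)
  have h2 := derivation_aeval D DC hlC hDC p b
  have hp0 : aeval b p = 0 := hCL (by rw [← aeval_algebraMap_apply, hp, map_zero])
  rw [hp0, map_zero] at h2
  have h3 := congrArg (algebraMap C L) h2
  rw [map_zero, map_add, map_mul, ← aeval_algebraMap_apply, ← aeval_algebraMap_apply] at h3
  rw [hp, map_zero, h3] at h1
  exact mul_left_cancel₀ hp' (add_left_cancel h1)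

theorem derivation_mem_intermediateField {k A K L : Type*} [CommRing k] [CommRing A]
    [CharZero A] [Algebra k A] [Field K] [Algebra A K] [Field L] [Algebra A L] [Algebra K L]
    [IsScalarTower A K L] (hinj : Function.Injective (algebraMap A L))
    (D : Derivation k A A) (D' : L →+ L)
    (hl : ∀ b c, D' (b * c) = b * D' c + c * D' b)
    (hD' : ∀ a, D' (algebraMap A L a) = algebraMap A L (D a)) (F : IntermediateField K L) (b : L)
    (hb : IsAlgebraic A b) (hbF : b ∈ F) : D' b ∈ F := by
  obtain ⟨p, hp, hp'⟩ := exists_derivative_ne_zero hinj _ hb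
  have h1 := derivation_aeval D D' hl hD' p b
  have hF : ∀ q : A[X], aeval b q ∈ F := fun q ↦ by
    rw [← aeval_map_algebraMap K]
    exact (aeval_algHom_apply F.val ⟨b, hbF⟩ (q.map (algebraMap A K))).symm ▸
      (aeval (⟨b, hbF⟩ : F) (q.map (algebraMap A K))).2
  rw [hp, map_zero] at h1
  have h2 : D' b = -(aeval b (mapCoeffDerivation D p)) / aeval b (derivative p) := by
    rw [eq_div_iff hp']
    linear_combination -h1
  rw [h2]
  exact F.div_mem (F.neg_mem (hF _)) (hF _)

theorem etale_integralClosure_of_derivations (k A K L : Type*) [Field k] [CharZero k] [IsAlgClosed k]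
    [CommRing A] [IsDomain A] [Algebra k A] [Algebra.FiniteType k A] [Algebra.FormallySmooth k A]
    [Field K] [Algebra A K] [IsFractionRing A K]
    [Field L] [Algebra K L] [Algebra A L] [IsScalarTower A K L]
    (hD : ∀ D : Derivation k A A, ∃ D' : L →+ L, (∀ b c, D' (b * c) = b * D' c + c * D' b) ∧
      (∀ a, D' (algebraMap A L a) = algebraMap A L (D a)) ∧ ∀ b, IsIntegral A b → IsIntegral A (D' b))
    (F : IntermediateField K L) [FiniteDimensional K F] :
    Module.Finite A (integralClosure A F) ∧ Algebra.Etale A (integralClosure A F) := by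
  have : CharZero A := charZero_of_injective_algebraMap (algebraMap k A).injective
  have hinj : Function.Injective (algebraMap A L) := by
    rw [IsScalarTower.algebraMap_eq A K L]
    exact (algebraMap K L).injective.comp (IsFractionRing.injective A K)
  have : Module.Finite A (integralClosure A F) := finite_integralClosure_of_finiteType k A K F
  have : IsScalarTower A F L := .of_algebraMap_eq fun a ↦ rfl
  refine ⟨‹_›, etale_of_derivations_extend k ?_ fun D ↦ ?_⟩
  · intro x y hxy
    apply hinj
    have := congrArg (fun z : integralClosure A F ↦ ((z : F) : L)) hxy
    exact this
  obtain ⟨D', hl, hD', hint⟩ := hD D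
  have hbL : ∀ b : integralClosure A F, IsIntegral A ((b : F) : L) := fun b ↦
    b.2.map (F.val.restrictScalars A)
  let f : integralClosure A F → integralClosure A F := fun b ↦
    ⟨⟨D' (b : F), derivation_mem_intermediateField hinj D D' hl hD' F _ (hbL b).isAlgebraic b.1.2⟩,
      (isIntegral_algebraMap_iff (B := L) F.val.injective).1 (hint _ (hbL b))⟩
  have hext : ∀ x y : integralClosure A F, ((x : F) : L) = (y : F) → x = y := fun x y h ↦
    Subtype.ext (Subtype.ext h)
  have hf : ∀ b, ((f b : F) : L) = D' (b : F) := fun b ↦ rfl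
  refine ⟨{ toFun := f, map_zero' := hext _ _ ?_, map_add' := fun x y ↦ hext _ _ ?_ },
    fun x y ↦ hext _ _ ?_, fun a ↦ hext _ _ ?_⟩
  · rw [hf]; simp
  · rw [hf]; simp [hf]
  · change ((f (x * y) : F) : L) = ((x * f y + y * f x : integralClosure A F) : F)
    rw [hf]; simp [hf, hl]
  · exact (hf _).trans (hD' a)

end

section

theorem homogeneousSubmodule_zero_algebraMap_surjective (k : Type u) [CommRing k] (σ : Type) :
    Function.Surjective (algebraMap k (MvPolynomial.homogeneousSubmodule σ k 0)) := by
  rintro ⟨p, hp⟩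
  rw [MvPolynomial.homogeneousSubmodule_zero, Submodule.mem_one] at hp
  obtain ⟨y, rfl⟩ := hp
  exact ⟨y, Subtype.ext rfl⟩

instance projectiveSpaceStruct_isProper (k : Type u) [CommRing k] (n : ℕ) :
    IsProper (projectiveSpaceStruct k n) := by
  have hs := homogeneousSubmodule_zero_algebraMap_surjective k (Fin (n + 1))
  have : IsScalarTower k (MvPolynomial.homogeneousSubmodule (Fin (n + 1)) k 0)
      (MvPolynomial (Fin (n + 1)) k) :=
    ⟨fun a b c => smul_mul_assoc a (b : MvPolynomial (Fin (n + 1)) k) c⟩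
  have : Algebra.FiniteType (MvPolynomial.homogeneousSubmodule (Fin (n + 1)) k 0)
      (MvPolynomial (Fin (n + 1)) k) := .of_restrictScalars_finiteType k _ _
  have : IsClosedImmersion (Spec.map (CommRingCat.ofHom
      (algebraMap k (MvPolynomial.homogeneousSubmodule (Fin (n + 1)) k 0)))) :=
    .spec_of_surjective _ hs
  have h₁ : IsProper (Proj.toSpecZero (MvPolynomial.homogeneousSubmodule (Fin (n + 1)) k)) :=
    inferInstance
  exact MorphismProperty.comp_mem @IsProper _ _ h₁ inferInstance

theorem ProjectiveMorphismOver.isProper {k : Type u} [CommRing k] {M X : Scheme.{u}}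
    {sX : X ⟶ Spec (CommRingCat.of k)} {h : M ⟶ X} (hh : ProjectiveMorphismOver k sX h) :
    IsProper h := by
  obtain ⟨n, ι, _, rfl⟩ := hh
  infer_instance

theorem QuasiProjectiveOver.locallyOfFiniteType {k : Type u} [CommRing k] {Z : Scheme.{u}}
    {sZ : Z ⟶ Spec (CommRingCat.of k)} (hZ : QuasiProjectiveOver k sZ) :
    LocallyOfFiniteType sZ := by
  obtain ⟨n, ι, _, rfl⟩ := hZ
  infer_instance

theorem QuasiProjectiveOver.isNoetherian {k : Type u} [Field k] {Z : Scheme.{u}}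
    {sZ : Z ⟶ Spec (CommRingCat.of k)} (hZ : QuasiProjectiveOver k sZ) :
    IsNoetherian Z := by
  have := hZ.locallyOfFiniteType
  have := LocallyOfFiniteType.isLocallyNoetherian sZ
  obtain ⟨n, ι, _, rfl⟩ := hZ
  have := LocallyOfFiniteType.isLocallyNoetherian (projectiveSpaceStruct k n)
  have : CompactSpace (ProjectiveSpaceOver k n) :=
    (quasiCompact_iff_compactSpace (projectiveSpaceStruct k n)).mp inferInstance
  have : IsNoetherian (ProjectiveSpaceOver k n) := {}
  have := ι.isEmbedding.isInducing.noetherianSpace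
  exact {}

/-- Two irreducible components through a point whose stalk is a domain agree. -/
theorem irreducibleComponents_eq_of_isDomain_stalk {M : Scheme.{u}} (x : M)
    [IsDomain (M.presheaf.stalk x)] {Z₁ Z₂ : Set M} (h₁ : Z₁ ∈ irreducibleComponents M)
    (h₂ : Z₂ ∈ irreducibleComponents M) (hx₁ : x ∈ Z₁) (hx₂ : x ∈ Z₂) : Z₁ = Z₂ := by
  let ζ : Spec (M.presheaf.stalk x) := genericPoint _
  have key : ∀ Z ∈ irreducibleComponents M, x ∈ Z → Z = closure {M.fromSpecStalk x ζ} := by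
    intro Z hZ hx
    obtain ⟨z, hz⟩ := QuasiSober.sober hZ.1 (isClosed_of_mem_irreducibleComponents Z hZ)
    have hzx : z ⤳ x := by rw [specializes_iff_mem_closure, hz.def]; exact hx
    obtain ⟨w, rfl⟩ : z ∈ Set.range (M.fromSpecStalk x) := by
      rw [Scheme.range_fromSpecStalk]; exact hzx
    have : M.fromSpecStalk x ζ ⤳ M.fromSpecStalk x w :=
      (genericPoint_specializes w).map (M.fromSpecStalk x).continuous
    refine le_antisymm ?_ (hZ.2 (isIrreducible_singleton.closure) ?_)
    · rw [← hz.def]; exact this.closure_subset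
    · rw [← hz.def]; exact this.closure_subset
  rw [key _ h₁ hx₁, key _ h₂ hx₂]

theorem isIntegral_of_connected_of_isDomain_stalk (M : Scheme.{u}) [IsNoetherian M]
    [ConnectedSpace M] (hM : ∀ x : M, IsDomain (M.presheaf.stalk x)) : IsIntegral M := by
  have hred : IsReduced M := @isReduced_of_isReduced_stalk M fun x => inferInstance
  have hfin := NoetherianSpace.finite_irreducibleComponents (α := M)
  obtain ⟨x⟩ : Nonempty M := inferInstance
  let Z := irreducibleComponent x
  have hZ : Z ∈ irreducibleComponents M := irreducibleComponent_mem_irreducibleComponents x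
  have hc : Zᶜ = ⋃₀ (irreducibleComponents M \ {Z}) := by
    ext y
    constructor
    · intro hy
      refine ⟨irreducibleComponent y, ⟨irreducibleComponent_mem_irreducibleComponents y, ?_⟩,
        mem_irreducibleComponent⟩
      rintro h
      exact hy (h ▸ mem_irreducibleComponent)
    · rintro ⟨W, ⟨hW, hWZ⟩, hy⟩ hyZ
      exact hWZ (irreducibleComponents_eq_of_isDomain_stalk y hW hZ hy hyZ)
  have hclopen : IsClopen Z := by
    refine ⟨isClosed_of_mem_irreducibleComponents Z hZ, ?_⟩
    rw [← isClosed_compl_iff, hc, Set.sUnion_eq_biUnion]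
    exact Set.Finite.isClosed_biUnion (hfin.subset Set.sdiff_subset)
      fun W hW => isClosed_of_mem_irreducibleComponents W hW.1
  have huniv : Z = Set.univ := hclopen.eq_univ ⟨x, mem_irreducibleComponent⟩
  have : IrreducibleSpace M := by
    have h1 : IsIrreducible (Set.univ : Set M) := huniv ▸ hZ.1
    exact { isPreirreducible_univ := h1.2, toNonempty := inferInstance }
  exact isIntegral_of_irreducibleSpace_of_isReduced M

end

section

namespace AlgebraicGeometry.Scheme

variable (M : Scheme.{u}) [IsIntegral M]

theorem genericPoint_mem {V : M.Opens} {x : M} (hx : x ∈ V) : genericPoint M ∈ V :=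
  (genericPoint_specializes x).mem_open V.isOpen hx

theorem residue_genericPoint_bijective :
    Function.Bijective (M.residue (genericPoint M)) := by
  have : IsField (M.presheaf.stalk (genericPoint M)) := Field.toIsField M.functionField
  let _ := this.toField
  exact ⟨(M.residue (genericPoint M)).hom.injective,
    IsLocalRing.residue_surjective⟩

/-- On an integral scheme, evaluation at the generic point is injective. -/
theorem evaluation_genericPoint_injective {V : M.Opens} (hV : genericPoint M ∈ V) :
    Function.Injective (M.evaluation V _ hV) := by
  have : Nonempty V := ⟨⟨_, hV⟩⟩
  have h1 := M.germToFunctionField_injective V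
  exact M.residue_genericPoint_bijective.1.comp h1

theorem isFractionRing_evaluation {V : M.Opens} (hV : genericPoint M ∈ V) (hV' : IsAffineOpen V) :
    let _ := (M.evaluation V _ hV).hom.toAlgebra
    IsFractionRing Γ(M, V) (M.residueField (genericPoint M)) := by
  have : Nonempty V := ⟨⟨_, hV⟩⟩
  let _ := (M.evaluation V _ hV).hom.toAlgebra
  have := functionField_isFractionRing_of_isAffineOpen M V hV'
  let e : M.functionField ≃ₐ[Γ(M, V)] M.residueField (genericPoint M) :=
    AlgEquiv.ofBijective { (M.residue (genericPoint M)).hom with commutes' := fun _ => rfl }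
      M.residue_genericPoint_bijective
  exact IsLocalization.isLocalization_of_algEquiv _ e

omit [IsIntegral M] in
theorem evaluation_map {V W : M.Opens} (i : V ⟶ W) {x : M} (hV : x ∈ V) (hW : x ∈ W) (s : Γ(M, W)) :
    M.evaluation V x hV (M.presheaf.map i.op s) = M.evaluation W x hW s := by
  change M.residue x (M.presheaf.germ V x hV (M.presheaf.map i.op s)) =
    M.residue x (M.presheaf.germ W x hW s)
  rw [TopCat.Presheaf.germ_res_apply]

/-- An element of the function field of an integral scheme is regular on an open subset if it is
the germ of a section there. -/
def IsRegularOn (V : M.Opens) (y : M.residueField (genericPoint M)) : Prop :=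
  ∃ (hV : genericPoint M ∈ V) (s : Γ(M, V)), M.evaluation V _ hV s = y

variable {M}

theorem IsRegularOn.mono {V W : M.Opens} {y} (h : M.IsRegularOn W y) (hVW : V ≤ W)
    (hV : genericPoint M ∈ V) : M.IsRegularOn V y := by
  obtain ⟨hW, s, rfl⟩ := h
  exact ⟨hV, M.presheaf.map (homOfLE hVW).op s, M.evaluation_map _ _ _ _⟩

theorem isRegularOn_of_forall_mem {W : M.Opens} {y} (hW : genericPoint M ∈ W)
    (h : ∀ x ∈ W, ∃ V : M.Opens, x ∈ V ∧ M.IsRegularOn V y) : M.IsRegularOn W y := by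
  choose! V hxV hV using h
  let U : W → M.Opens := fun x => V x ⊓ W
  have hU : ∀ x, genericPoint M ∈ U x := fun x => M.genericPoint_mem (x := x.1) ⟨hxV _ x.2, x.2⟩
  have hreg : ∀ x, M.IsRegularOn (U x) y := fun x => (hV x x.2).mono inf_le_left (hU x)
  choose hg s hs using hreg
  obtain ⟨t, ht, -⟩ := M.sheaf.existsUnique_gluing' U W (fun x => homOfLE inf_le_right)
    (fun x hx => Opens.mem_iSup.mpr ⟨⟨x, hx⟩, hxV x hx, hx⟩) s (by
      intro i j
      have hij : genericPoint M ∈ U i ⊓ U j := ⟨hU i, hU j⟩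
      apply M.evaluation_genericPoint_injective hij
      refine (M.evaluation_map _ hij (hU i) (s i)).trans ?_
      refine Eq.trans ?_ (M.evaluation_map _ hij (hU j) (s j)).symm
      rw [hs, hs])
  refine ⟨hW, t, ?_⟩
  let x : W := ⟨_, hW⟩
  rw [← hs x, ← ht x]
  exact (M.evaluation_map _ _ _ _).symm

omit [IsIntegral M] in
theorem _root_.AlgebraicGeometry.IsAffineOpen.exists_primeIdealOf_eq {V : M.Opens}
    (hV : IsAffineOpen V) (q : PrimeSpectrum Γ(M, V)) : ∃ m : V, hV.primeIdealOf m = q := by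
  have hm : hV.fromSpec q ∈ Set.range hV.fromSpec := Set.mem_range_self _
  rw [hV.range_fromSpec] at hm
  exact ⟨⟨_, hm⟩, hV.fromSpec.isOpenEmbedding.injective (hV.fromSpec_primeIdealOf _)⟩

theorem isIntegrallyClosed_of_isAffineOpen (hM : ∀ x : M, IsIntegrallyClosed (M.presheaf.stalk x))
    {V : M.Opens} (hV : IsAffineOpen V) [Nonempty V] : IsIntegrallyClosed Γ(M, V) := by
  refine IsIntegrallyClosed.of_localization_maximal fun p _ hp => ?_
  obtain ⟨m, hm⟩ := hV.exists_primeIdealOf_eq ⟨p, inferInstance⟩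
  obtain rfl : (hV.primeIdealOf m).asIdeal = p := congrArg PrimeSpectrum.asIdeal hm
  let _ := TopCat.Presheaf.algebra_section_stalk M.presheaf m
  have h1 := hV.isLocalization_stalk m
  have := hM m
  exact .of_equiv (IsLocalization.algEquiv (hV.primeIdealOf m).asIdeal.primeCompl
    (M.presheaf.stalk m.1) (Localization.AtPrime (hV.primeIdealOf m).asIdeal)).toRingEquiv

omit [IsIntegral M] in
open Order in
theorem height_primeIdealOf_eq_coheight {V : M.Opens} (hV : IsAffineOpen V) (m : V) :
    (hV.primeIdealOf m).asIdeal.height = coheight (m : M) := by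
  have h1 := coheight_eq_of_isOpenImmersion (x := hV.primeIdealOf m) hV.fromSpec
  refine (idealHeight_eq_coheight Γ(M, V) (hV.primeIdealOf m)).trans (h1.symm.trans ?_)
  exact congrArg coheight (hV.fromSpec_primeIdealOf m)

open Order in
/-- Algebraic Hartogs lemma on a normal scheme. -/
theorem isRegularOn_of_coheight_le_one [IsLocallyNoetherian M]
    (hM : ∀ x : M, IsIntegrallyClosed (M.presheaf.stalk x))
    {V : M.Opens} (hV : IsAffineOpen V) (hgV : genericPoint M ∈ V)
    (y : M.residueField (genericPoint M))
    (h : ∀ m ∈ V, coheight m ≤ 1 → ∃ W : M.Opens, m ∈ W ∧ M.IsRegularOn W y) :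
    M.IsRegularOn V y := by
  have : Nonempty V := ⟨⟨_, hgV⟩⟩
  have := isIntegrallyClosed_of_isAffineOpen hM hV
  have : IsNoetherianRing Γ(M, V) := IsLocallyNoetherian.component_noetherian ⟨V, hV⟩
  let _ := (M.evaluation V _ hgV).hom.toAlgebra
  have := M.isFractionRing_evaluation hgV hV
  obtain ⟨s, hs⟩ := IsIntegrallyClosed.mem_range_of_height_le_one (C := Γ(M, V)) y (by
    intro p hp hpht
    obtain ⟨m, h2⟩ := hV.exists_primeIdealOf_eq ⟨p, hp⟩
    have hm : coheight (m : M) ≤ 1 := by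
      rw [← height_primeIdealOf_eq_coheight hV, h2]
      exact hpht
    obtain ⟨W, hmW, hW⟩ := h m m.2 hm
    obtain ⟨f, hfW, hmf⟩ := hV.exists_basicOpen_le (V := W) ⟨m, hmW⟩ m.2
    have hgf := M.genericPoint_mem hmf
    obtain ⟨_, t, ht⟩ := hW.mono hfW hgf
    have := hV.isLocalization_basicOpen f
    obtain ⟨⟨c, ⟨_, n, rfl⟩⟩, hc⟩ := IsLocalization.surj (Submonoid.powers f) t
    have hle : M.basicOpen f ≤ V := M.basicOpen_le f
    refine ⟨f ^ n, ?_, c, ?_⟩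
    · intro hfn
      have hfp : f ∈ p := hp.mem_of_pow_mem n hfn
      have h4 : hV.primeIdealOf m ∈ hV.fromSpec ⁻¹ᵁ (M.basicOpen f) := by
        change hV.fromSpec (hV.primeIdealOf m) ∈ M.basicOpen f
        rwa [hV.fromSpec_primeIdealOf]
      rw [hV.fromSpec_preimage_basicOpen, h2] at h4
      exact h4 hfp
    · have h5 := congrArg (M.evaluation _ _ hgf) hc
      rw [map_mul, ht] at h5
      have h6 : ∀ z : Γ(M, V), M.evaluation _ _ hgf (algebraMap Γ(M, V) Γ(M, M.basicOpen f) z) =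
        M.evaluation V _ hgV z := fun z => M.evaluation_map (homOfLE hle) hgf hgV z
      rw [h6, h6, mul_comm] at h5
      exact h5.symm)
  exact ⟨hgV, s, hs⟩

end AlgebraicGeometry.Scheme

end

section

namespace AlgebraicGeometry.Scheme

theorem evaluation_injective_of_eq {X : Scheme.{u}} [IsIntegral X] {x : X}
    (hx : x = genericPoint X) {U : X.Opens} (hU : x ∈ U) :
    Function.Injective (X.evaluation U x hU) := by
  subst hx
  exact X.evaluation_genericPoint_injective hU

theorem isFractionRing_evaluation_of_eq {X : Scheme.{u}} [IsIntegral X] {x : X}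
    (hx : x = genericPoint X) {U : X.Opens} (hU : x ∈ U) (hU' : IsAffineOpen U) :
    let _ := (X.evaluation U x hU).hom.toAlgebra
    IsFractionRing Γ(X, U) (X.residueField x) := by
  subst hx
  exact X.isFractionRing_evaluation hU hU'

end AlgebraicGeometry.Scheme

variable {M X : Scheme.{u}} {h : M ⟶ X}

theorem SmoothAtPoint.exists_isAffineOpen {m : M} (hm : SmoothAtPoint h m) {U : X.Opens}
    (hU : IsAffineOpen U) (hmU : h m ∈ U) {O : M.Opens} (hmO : m ∈ O) :
    ∃ V : M.Opens, IsAffineOpen V ∧ m ∈ V ∧ V ≤ O ∧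
      ∃ e : V ≤ h ⁻¹ᵁ U, (h.appLE U V e).hom.FormallySmooth := by
  obtain ⟨W, hmW, hW⟩ := hm
  change Smooth (W.ι ≫ h) at hW
  obtain ⟨V, hV, hmV, hle⟩ := exists_isAffineOpen_mem_and_subset (X := M) (x := m)
    (U := W ⊓ O ⊓ h ⁻¹ᵁ U) ⟨⟨hmW, hmO⟩, hmU⟩
  have hle' : V ≤ W ⊓ O ⊓ h ⁻¹ᵁ U := hle
  have e : V ≤ h ⁻¹ᵁ U := hle'.trans inf_le_right
  refine ⟨V, hV, hmV, hle'.trans (inf_le_left.trans inf_le_right), e, ?_⟩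
  have hVW : V ≤ W := hle'.trans (inf_le_left.trans inf_le_left)
  let j : Spec Γ(M, V) ⟶ W := IsOpenImmersion.lift W.ι hV.fromSpec (by
    rw [hV.range_fromSpec, Scheme.Opens.range_ι]; exact hVW)
  have hj : j ≫ W.ι = hV.fromSpec := IsOpenImmersion.lift_fac _ _ _
  have : IsOpenImmersion j := by
    have : IsOpenImmersion (j ≫ W.ι) := hj ▸ inferInstance
    exact IsOpenImmersion.of_comp j W.ι
  have h1 : Smooth (Spec.map (h.appLE U V e) ≫ hU.fromSpec) := by
    rw [hU.SpecMap_appLE_fromSpec h hV e, ← hj, Category.assoc]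
    infer_instance
  have h2 : Smooth (Spec.map (h.appLE U V e)) :=
    (instHasOfPostcompPropertySchemeIsOpenImmersionOfIsStableUnderBaseChange
      @Smooth.{u}).of_postcomp _ hU.fromSpec inferInstance h1
  exact ((HasRingHomProperty.Spec_iff (P := @Smooth.{u})).mp h2).formallySmooth

theorem isClosed_setOf_not_smoothAtPoint (h : M ⟶ X) : IsClosed {x : M | ¬ SmoothAtPoint h x} := by
  rw [← isOpen_compl_iff, isOpen_iff_forall_mem_open]
  intro x hx
  obtain ⟨U, hxU, hU⟩ := not_not.mp hx
  exact ⟨U, fun y hy => not_not.mpr ⟨U, hy, hU⟩, U.isOpen, hxU⟩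

attribute [local instance] specializationOrder in
theorem smoothAtPoint_of_coheight_lt_two (hcodim : ∀ T : IrreducibleCloseds M,
      (T : Set M) ⊆ {x : M | ¬ SmoothAtPoint h x} → 2 ≤ Order.coheight T) (m : M)
    (hm : Order.coheight m ≤ 1) : SmoothAtPoint h m := by
  by_contra hns
  have h1 := hcodim (irreducibleSetEquivPoints.symm m) (by
    rw [coe_irreducibleEquivPoints_symm_apply]
    exact (isClosed_setOf_not_smoothAtPoint h).closure_subset_iff.mpr
      (Set.singleton_subset_iff.mpr hns))
  rw [Order.coheight_orderIso] at h1
  have h2 : (2 : ℕ∞) ≤ 1 := h1.trans hm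
  exact absurd h2 (by decide)

theorem SmoothAtPoint.map_genericPoint [IrreducibleSpace M] [IrreducibleSpace X]
    (hs : SmoothAtPoint h (genericPoint M)) : h (genericPoint M) = genericPoint X := by
  obtain ⟨U, hU, hsm⟩ := hs
  change Smooth (U.ι ≫ h) at hsm
  obtain ⟨z, hz, hz'⟩ := Flat.generalizingMap (U.ι ≫ h) (a := ⟨genericPoint M, hU⟩)
    (b := genericPoint X) (genericPoint_specializes _)
  have h1 : (U.ι z : M) = genericPoint M := by
    have h2 := hz.map U.ι.continuous
    exact (h2.antisymm (genericPoint_specializes _)).eq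
  rw [← hz', ← h1]
  rfl

end

section

variable {M X : Scheme.{u}}

theorem RingHom.FormallySmooth.of_isFractionRing {C L : Type u} [CommRing C] [CommRing L]
    [Algebra C L] [IsFractionRing C L] : Algebra.FormallySmooth C L :=
  Algebra.FormallySmooth.of_isLocalization (nonZeroDivisors C)

/-- Sections over the preimage of an affine open are integral over the base, for a universally
closed morphism. -/
theorem AlgebraicGeometry.IsAffineOpen.isIntegral_app_of_universallyClosed (h : M ⟶ X)
    [UniversallyClosed h] {U : X.Opens} (hU : IsAffineOpen U) : (h.app U).hom.IsIntegral := by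
  have : IsAffine U := hU
  have h1 := isIntegral_appTop_of_universallyClosed (h ∣_ U)
  rw [Scheme.Hom.appTop, morphismRestrict_app'] at h1
  rw [← Scheme.Hom.appLE_eq_app]
  exact (h.appLE_congr _ U.ι_image_top (h ⁻¹ᵁ U).ι_image_top (fun f => f.hom.IsIntegral)).mp h1

theorem exists_derivation_extends_functionField {k : Type u} [Field k] [CharZero k]
    [IsIntegral M] [IsIntegral X] [IsLocallyNoetherian M]
    (hM : ∀ x : M, IsIntegrallyClosed (M.presheaf.stalk x)) (h : M ⟶ X) [UniversallyClosed h]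
    (hsm : ∀ m : M, Order.coheight m ≤ 1 → SmoothAtPoint h m)
    (hη : h (genericPoint M) = genericPoint X) {U : X.Opens} (hU : IsAffineOpen U)
    (hξ : h (genericPoint M) ∈ U) [Algebra k Γ(X, U)] (D : Derivation k Γ(X, U) Γ(X, U)) :
    let _ := ((h.residueFieldMap (genericPoint M)).hom.comp
      (X.evaluation U _ hξ).hom).toAlgebra
    ∃ D' : M.residueField (genericPoint M) →+ M.residueField (genericPoint M),
      (∀ b c, D' (b * c) = b * D' c + c * D' b) ∧
      (∀ a, D' (algebraMap Γ(X, U) _ a) = algebraMap Γ(X, U) _ (D a)) ∧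
      ∀ b, IsIntegral Γ(X, U) b → IsIntegral Γ(X, U) (D' b) := by
  intro _
  have halg : ∀ a, algebraMap Γ(X, U) (M.residueField (genericPoint M)) a =
      M.evaluation (h ⁻¹ᵁ U) _ hξ (h.app U a) := fun a =>
    Scheme.evaluation_naturality_apply h _ hξ a
  have hinj : Function.Injective (algebraMap Γ(X, U) (M.residueField (genericPoint M))) :=
    (h.residueFieldMap (genericPoint M)).hom.injective.comp
      (Scheme.evaluation_injective_of_eq hη hξ)
  have : Nonempty U := ⟨⟨_, hξ⟩⟩
  have : CharZero Γ(X, U) := charZero_of_injective_algebraMap (algebraMap k Γ(X, U)).injective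
  -- evaluation through an affine open contained in the preimage
  have hev : ∀ (V : M.Opens) (e : V ≤ h ⁻¹ᵁ U) (hV : genericPoint M ∈ V) (a : Γ(X, U)),
      M.evaluation V _ hV (h.appLE U V e a) = algebraMap Γ(X, U) _ a := fun V e hV a => by
    rw [halg]
    exact M.evaluation_map (homOfLE e) hV hξ _
  obtain ⟨D', hl, hD'⟩ : ∃ D' : M.residueField (genericPoint M) →+ M.residueField (genericPoint M),
      (∀ b c, D' (b * c) = b * D' c + c * D' b) ∧
      (∀ a, D' (algebraMap Γ(X, U) _ a) = algebraMap Γ(X, U) _ (D a)) := by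
    obtain ⟨V, hV, hmV, -, e, hsmV⟩ := (hsm (genericPoint M) (by
      have : Order.coheight (genericPoint M) = 0 := Order.coheight_eq_zero.mpr isMax_top
      rw [this]; exact zero_le_one)).exists_isAffineOpen hU hξ (O := h ⁻¹ᵁ U) hξ
    let _ := (h.appLE U V e).hom.toAlgebra
    let _ := (M.evaluation V _ hmV).hom.toAlgebra
    have := M.isFractionRing_evaluation hmV hV
    have : IsScalarTower Γ(X, U) Γ(M, V) (M.residueField (genericPoint M)) :=
      .of_algebraMap_eq fun a => (hev V e hmV a).symm
    have : Algebra.FormallySmooth Γ(X, U) Γ(M, V) := hsmV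
    have : Algebra.FormallySmooth Γ(M, V) (M.residueField (genericPoint M)) :=
      RingHom.FormallySmooth.of_isFractionRing
    have : Algebra.FormallySmooth Γ(X, U) (M.residueField (genericPoint M)) :=
      .comp _ Γ(M, V) _
    exact FormallySmooth.exists_derivation_extends D
  refine ⟨D', hl, hD', fun y hy => ?_⟩
  have hreg : ∀ V : M.Opens, IsAffineOpen V → genericPoint M ∈ V → V ≤ h ⁻¹ᵁ U →
      M.IsRegularOn V y := by
    intro V hV hgV e
    have : Nonempty V := ⟨⟨_, hgV⟩⟩
    have := Scheme.isIntegrallyClosed_of_isAffineOpen hM hV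
    let _ := (h.appLE U V e).hom.toAlgebra
    let _ := (M.evaluation V _ hgV).hom.toAlgebra
    have := M.isFractionRing_evaluation hgV hV
    have : IsScalarTower Γ(X, U) Γ(M, V) (M.residueField (genericPoint M)) :=
      .of_algebraMap_eq fun a => (hev V e hgV a).symm
    obtain ⟨s, hs⟩ := IsIntegrallyClosed.isIntegral_iff.mp (hy.tower_top (A := Γ(M, V)))
    exact ⟨hgV, s, hs⟩
  have hDreg : M.IsRegularOn (h ⁻¹ᵁ U) (D' y) := by
    refine Scheme.isRegularOn_of_forall_mem hξ fun x hx => ?_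
    obtain ⟨V, hV, hxV, e⟩ := exists_isAffineOpen_mem_and_subset (X := M) (x := x)
      (U := h ⁻¹ᵁ U) hx
    have e : V ≤ h ⁻¹ᵁ U := e
    refine ⟨V, hxV, Scheme.isRegularOn_of_coheight_le_one hM hV (M.genericPoint_mem hxV) _ ?_⟩
    intro m hmV hm
    obtain ⟨W, hW, hmW, -, e', hsmW⟩ := (hsm m hm).exists_isAffineOpen hU (e hmV) (e hmV)
    have hgW := M.genericPoint_mem hmW
    let _ := (h.appLE U W e').hom.toAlgebra
    let _ := (M.evaluation W _ hgW).hom.toAlgebra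
    have : IsScalarTower Γ(X, U) Γ(M, W) (M.residueField (genericPoint M)) :=
      .of_algebraMap_eq fun a => (hev W e' hgW a).symm
    have : Algebra.FormallySmooth Γ(X, U) Γ(M, W) := hsmW
    obtain ⟨_, b, hb⟩ := hreg W hW hgW e'
    obtain ⟨t, ht⟩ := derivation_mem_range_of_formallySmooth (C := Γ(M, W)) hinj D D' hl hD' b
      (by
        change IsAlgebraic _ (M.evaluation W _ hgW b)
        rw [hb]; exact hy.isAlgebraic)
      (M.evaluation_genericPoint_injective hgW)
    refine ⟨W, hmW, hgW, t, ?_⟩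
    rw [← hb]
    exact ht
  obtain ⟨_, t, ht⟩ := hDreg
  obtain ⟨p, hp, hp'⟩ := hU.isIntegral_app_of_universallyClosed h t
  refine ⟨p, hp, ?_⟩
  have : algebraMap Γ(X, U) (M.residueField (genericPoint M)) =
      (M.evaluation (h ⁻¹ᵁ U) _ hξ).hom.comp (h.app U).hom := RingHom.ext halg
  rw [this, ← ht]
  exact (Polynomial.hom_eval₂ p (h.app U).hom (M.evaluation (h ⁻¹ᵁ U) _ hξ).hom t).symm.trans
    (by rw [hp', map_zero])

end

section
variable {X : Scheme.{u}}

theorem AlgebraicGeometry.Scheme.SpecMap_fromSpecStalk_app (x : X) {S : CommRingCat.{u}}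
    (φ : X.presheaf.stalk x ⟶ S) {U : X.Opens} (hxU : x ∈ U) :
    (Spec.map φ ≫ X.fromSpecStalk x).app U = X.presheaf.germ U x hxU ≫ φ ≫
      (Scheme.ΓSpecIso S).inv ≫ (Spec S).presheaf.map (homOfLE le_top).op := by
  rw [Scheme.Hom.comp_app, Scheme.fromSpecStalk_app hxU, Category.assoc, Category.assoc,
    Scheme.Hom.naturality]
  have := congrArg (fun f ↦ X.presheaf.germ U x hxU ≫ f ≫ (Spec S).presheaf.map
    (homOfLE (le_top : (Spec.map φ ≫ X.fromSpecStalk x) ⁻¹ᵁ U ≤ ⊤)).op)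
    (Scheme.ΓSpecIso_inv_naturality φ)
  simp only [Category.assoc] at this
  exact this.symm

/-- Sections of `X` pulled back along `Spec F ⟶ Spec κ(x) ⟶ X` are evaluated at `x`. -/
theorem AlgebraicGeometry.Scheme.exists_ringEquiv_app_fromSpecResidueField (x : X)
    {F : CommRingCat.{u}} (φ : X.residueField x ⟶ F) {U : X.Opens} (hxU : x ∈ U) :
    ∃ e : Γ(Spec F, (Spec.map φ ≫ X.fromSpecResidueField x) ⁻¹ᵁ U) ≃+* F,
      ∀ a, e (((Spec.map φ ≫ X.fromSpecResidueField x).app U).hom a) =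
        φ.hom ((X.evaluation U x hxU).hom a) := by
  set g := Spec.map φ ≫ X.fromSpecResidueField x with hg
  have h1 : g ⁻¹ᵁ U = ⊤ := by
    ext y
    have : (X.fromSpecResidueField x) ((Spec.map φ) y) = x :=
      Scheme.fromSpecResidueField_apply _ _
    simp [g, this, hxU]
  let i : F ≅ Γ(Spec F, g ⁻¹ᵁ U) :=
    (Scheme.ΓSpecIso F).symm ≪≫ (Spec F).presheaf.mapIso (eqToIso h1.symm).op.symm
  have h2 : g.app U = X.evaluation U x hxU ≫ φ ≫ i.hom := by
    have h3 := X.SpecMap_fromSpecStalk_app x (X.residue x ≫ φ) hxU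
    have h4 : g = Spec.map (X.residue x ≫ φ) ≫ X.fromSpecStalk x := by
      rw [Spec.map_comp, Category.assoc]; rfl
    rw [Scheme.Hom.congr_app h4, h3]
    simp only [Category.assoc, Scheme.evaluation, ← Functor.map_comp]
    rfl
  have h3 : g.app U ≫ i.inv = X.evaluation U x hxU ≫ φ := by
    rw [h2, Category.assoc, Category.assoc, i.hom_inv_id, Category.comp_id]
  exact ⟨i.symm.commRingCatIsoToRingEquiv, fun a ↦ congrArg (fun f ↦ f.hom a) h3⟩

theorem Algebra.Etale.integralClosure_of_algEquiv {A B C : Type*} [CommRing A] [CommRing B]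
    [CommRing C] [Algebra A B] [Algebra A C] (e : B ≃ₐ[A] C)
    [Algebra.Etale A (integralClosure A C)] : Algebra.Etale A (integralClosure A B) :=
  .of_equiv e.mapIntegralClosure.symm

theorem RingHom.Etale.holdsForLocalizationAway : RingHom.HoldsForLocalizationAway RingHom.Etale := by
  intro R S _ _ _ r _
  exact RingHom.etale_algebraMap.2 (.of_isLocalizationAway r)

theorem surjective_algebraMap_of_surjective_integralClosure {A B K F : Type*} [CommRing A]
    [IsDomain A] [CommRing B] [Algebra A B] [Field K] [Algebra A K] [IsFractionRing A K] [Field F] [Algebra K F]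
    [Algebra A F] [IsScalarTower A K F] [Algebra.IsAlgebraic K F] (e : B ≃ₐ[A] F)
    (hA : Function.Surjective (algebraMap A (integralClosure A B))) :
    Function.Surjective (algebraMap K F) := by
  intro y
  have hy : IsAlgebraic A y :=
    (IsFractionRing.isAlgebraic_iff A K F).2 (Algebra.IsAlgebraic.isAlgebraic y)
  obtain ⟨a, ha, hay⟩ := hy.exists_integral_multiple
  obtain ⟨b, hb⟩ := hA ⟨e.symm (a • y), hay.map e.symm⟩
  have hb' : algebraMap A F b = algebraMap A F a * y := by
    have h2 := congrArg (fun z ↦ e z.1) hb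
    rw [← Algebra.smul_def, ← e.apply_symm_apply (a • y), ← h2]
    exact (e.commutes b).symm
  have ha' : algebraMap A K a ≠ 0 := by simpa using ha
  refine ⟨algebraMap A K b / algebraMap A K a, ?_⟩
  rw [map_div₀, ← IsScalarTower.algebraMap_apply, ← IsScalarTower.algebraMap_apply, hb',
    mul_div_cancel_left₀]
  rw [IsScalarTower.algebraMap_apply A K F]
  simpa using ha

theorem surjective_of_isClosedMap_of_genericPoint_mem_range {Z : Scheme.{u}} [IsIntegral X]
    (f : Z ⟶ X) (hf : IsClosedMap f) (hη : genericPoint X ∈ Set.range f) :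
    Function.Surjective f := by
  rw [← Set.range_eq_univ, ← Set.univ_subset_iff, ← (genericPoint_spec X).def]
  exact closure_minimal (Set.singleton_subset_iff.2 hη) hf.isClosed_range

theorem surjective_algebraMap_of_algebraicallySimplyConnected [IsIntegral X]
    (hX : AlgebraicallySimplyConnected X) (x : X) (hx : x = genericPoint X) {F : Type u} [Field F]
    [Algebra (X.residueField x) F] [Algebra.IsAlgebraic (X.residueField x) F]
    (het : ∀ (U : X.Opens) (_ : IsAffineOpen U) (hxU : x ∈ U),
      let _ := ((algebraMap (X.residueField x) F).comp (X.evaluation U x hxU).hom).toAlgebra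
      Algebra.Etale Γ(X, U) (integralClosure Γ(X, U) F)) :
    Function.Surjective (algebraMap (X.residueField x) F) := by
  set φ : X.residueField x ⟶ .of F := CommRingCat.ofHom (algebraMap (X.residueField x) F)
  set g := Spec.map φ ≫ X.fromSpecResidueField x with hg
  have hxmem {U : X.Opens} {z : X} (hz : z ∈ U) : x ∈ U := hx ▸ X.genericPoint_mem hz
  have het' : Etale g.fromNormalization := by
    rw [HasRingHomProperty.iff_exists_appLE (P := @Etale.{u})
      (RingHom.Etale.stableUnderComposition.stableUnderCompositionWithLocalizationAway
        RingHom.Etale.holdsForLocalizationAway).1]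
    intro z
    obtain ⟨_, ⟨U, hU, rfl⟩, hzU, -⟩ := X.isBasis_affineOpens.exists_subset_of_mem_open
      (Set.mem_univ (g.fromNormalization z)) isOpen_univ
    refine ⟨⟨U, hU⟩, ⟨g.fromNormalization ⁻¹ᵁ U, hU.preimage _⟩, hzU, le_rfl, ?_⟩
    have hxU := hxmem hzU
    rw [Scheme.Hom.appLE_eq_app, Scheme.Hom.fromNormalization_app _ hU]
    let _ := ((algebraMap (X.residueField x) F).comp (X.evaluation U x hxU).hom).toAlgebra
    let _ := (g.app U).hom.toAlgebra
    obtain ⟨e, he⟩ := X.exists_ringEquiv_app_fromSpecResidueField x φ hxU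
    let e' : Γ(Spec (.of F), g ⁻¹ᵁ U) ≃ₐ[Γ(X, U)] F := AlgEquiv.ofRingEquiv (f := e) he
    have := het U hU hxU
    have := Algebra.Etale.integralClosure_of_algEquiv e'
    exact RingHom.Etale.respectsIso.1 _ (g.normalizationObjIso hU).symm.commRingCatIsoToRingEquiv
      (RingHom.etale_algebraMap.2 this)
  have hfin : IsFinite g.fromNormalization := by
    rw [IsFinite.iff_isIntegralHom_and_locallyOfFiniteType]
    exact ⟨inferInstance, inferInstance⟩
  have hxr : x ∈ Set.range g.fromNormalization := by
    obtain ⟨y⟩ : Nonempty (Spec (.of F)) := inferInstance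
    refine ⟨g.toNormalization y, ?_⟩
    rw [← Scheme.Hom.comp_apply, g.toNormalization_fromNormalization, hg, Scheme.Hom.comp_apply]
    exact Scheme.fromSpecResidueField_apply x (Spec.map φ y)
  have hsurj := surjective_of_isClosedMap_of_genericPoint_mem_range g.fromNormalization
    g.fromNormalization.isClosedMap (hx ▸ hxr)
  have hiso := hX _ g.fromNormalization inferInstance inferInstance hfin het' hsurj
  obtain ⟨_, ⟨U, hU, rfl⟩, hxU, -⟩ := X.isBasis_affineOpens.exists_subset_of_mem_open
    (Set.mem_univ x) isOpen_univ
  let _ := ((algebraMap (X.residueField x) F).comp (X.evaluation U x hxU).hom).toAlgebra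
  let _ := (g.app U).hom.toAlgebra
  obtain ⟨e, he⟩ := X.exists_ringEquiv_app_fromSpecResidueField x φ hxU
  let e' : Γ(Spec (.of F), g ⁻¹ᵁ U) ≃ₐ[Γ(X, U)] F := AlgEquiv.ofRingEquiv (f := e) he
  have hbij : Function.Surjective
      (algebraMap Γ(X, U) (integralClosure Γ(X, U) Γ(Spec (.of F), g ⁻¹ᵁ U))) := by
    have h1 : IsIso (g.fromNormalization.app U) := inferInstance
    rw [Scheme.Hom.fromNormalization_app _ hU, isIso_comp_right_iff] at h1
    exact (ConcreteCategory.bijective_of_isIso (CommRingCat.ofHom (algebraMap Γ(X, U)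
      (integralClosure Γ(X, U) Γ(Spec (.of F), g ⁻¹ᵁ U))))).2
  let _ := (X.evaluation U x hxU).hom.toAlgebra
  have : IsFractionRing Γ(X, U) (X.residueField x) := Scheme.isFractionRing_evaluation_of_eq hx hxU hU
  have : IsScalarTower Γ(X, U) (X.residueField x) F := .of_algebraMap_eq fun _ ↦ rfl
  have : Nonempty U := ⟨⟨x, hxU⟩⟩
  exact surjective_algebraMap_of_surjective_integralClosure e' hbij

end

section

open IntermediateField
variable {M X : Scheme.{u}}

/-- A smooth scheme over `k` has smooth `k`-algebras of sections over its affine opens. -/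
theorem exists_algebra_smooth_of_isAffineOpen {k : Type u} [CommRing k]
    (sX : X ⟶ Spec (CommRingCat.of k)) [Smooth sX] {U : X.Opens} (hU : IsAffineOpen U) :
    ∃ _ : Algebra k Γ(X, U), Algebra.Smooth k Γ(X, U) := by
  have h1 := sX.smooth_appLE (isAffineOpen_top _) hU le_top
  let e := (Scheme.ΓSpecIso (.of k)).symm.commRingCatIsoToRingEquiv
  have h2 := RingHom.Smooth.respectsIso.2 _ e h1
  exact ⟨_, h2⟩

theorem isIntegral_mem_range_residueFieldMap {k : Type u} [Field k] [CharZero k] [IsAlgClosed k]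
    [IsIntegral M] [IsIntegral X] [IsLocallyNoetherian M]
    (sX : X ⟶ Spec (CommRingCat.of k)) [Smooth sX] (hX : AlgebraicallySimplyConnected X)
    (hM : ∀ x : M, IsIntegrallyClosed (M.presheaf.stalk x)) (h : M ⟶ X) [UniversallyClosed h]
    (hsm : ∀ m : M, Order.coheight m ≤ 1 → SmoothAtPoint h m)
    (hη : h (genericPoint M) = genericPoint X) :
    let _ := (h.residueFieldMap (genericPoint M)).hom.toAlgebra
    ∀ y : M.residueField (genericPoint M),
      IsIntegral (X.residueField (h (genericPoint M))) y → y ∈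
      (algebraMap (X.residueField (h (genericPoint M))) (M.residueField (genericPoint M))).range := by
  intro _ y hy
  let K := X.residueField (h (genericPoint M))
  let L := M.residueField (genericPoint M)
  let F := K⟮y⟯
  have : FiniteDimensional K F := adjoin.finiteDimensional hy
  have hs := surjective_algebraMap_of_algebraicallySimplyConnected hX (h (genericPoint M)) hη (F := F)
    fun U hU hxU ↦ by
      intro _
      obtain ⟨_, _⟩ := exists_algebra_smooth_of_isAffineOpen sX hU
      let _ : Algebra Γ(X, U) K := (X.evaluation U _ hxU).hom.toAlgebra
      let _ : Algebra Γ(X, U) L := ((h.residueFieldMap (genericPoint M)).hom.comp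
        (X.evaluation U _ hxU).hom).toAlgebra
      have : IsFractionRing Γ(X, U) K := Scheme.isFractionRing_evaluation_of_eq hη hxU hU
      have : IsScalarTower Γ(X, U) K L := .of_algebraMap_eq fun _ ↦ rfl
      have : Nonempty U := ⟨⟨_, hxU⟩⟩
      have hD := fun D : Derivation k Γ(X, U) Γ(X, U) ↦
        exists_derivation_extends_functionField hM h hsm hη hU hxU D
      exact (etale_integralClosure_of_derivations k Γ(X, U) K L hD F).2
  obtain ⟨a, ha⟩ := hs ⟨y, mem_adjoin_simple_self K y⟩
  exact ⟨a, congrArg Subtype.val ha⟩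
end

section

open TensorProduct
variable {M X : Scheme.{u}}

theorem flat_fromSpecStalk (x : X) : Flat (X.fromSpecStalk x) := by
  obtain ⟨U, hU, hxU, -⟩ := exists_isAffineOpen_mem_and_subset (X := X) (x := x) (U := ⊤) trivial
  rw [← hU.fromSpecStalk_eq_fromSpecStalk hxU, IsAffineOpen.fromSpecStalk]
  let _ := (X.presheaf.germ U x hxU).hom.toAlgebra
  have : IsLocalization.AtPrime (X.presheaf.stalk x) (hU.primeIdealOf ⟨x, hxU⟩).asIdeal :=
    hU.isLocalization_stalk ⟨x, hxU⟩
  have : Flat (Spec.map (X.presheaf.germ U x hxU)) := by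
    rw [Flat.SpecMap_iff]
    exact IsLocalization.flat (X.presheaf.stalk x) (hU.primeIdealOf ⟨x, hxU⟩).asIdeal.primeCompl
  infer_instance

theorem flat_fromSpecResidueField_genericPoint [IsIntegral X] :
    Flat (X.fromSpecResidueField (genericPoint X)) := by
  have := flat_fromSpecStalk (genericPoint X)
  have : Flat (Spec.map (X.residue (genericPoint X))) := by
    rw [Flat.SpecMap_iff]
    exact RingHom.Flat.of_bijective X.residue_genericPoint_bijective
  exact Flat.comp _ _

theorem connectedSpace_of_generalizingMap {Y Z T : Type*} [TopologicalSpace Y] [TopologicalSpace Z]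
    [TopologicalSpace T] [IrreducibleSpace T] (f : Y → Z) (hf : GeneralizingMap f) (ξ : Z)
    (hξ : ∀ z, ξ ⤳ z) (j : T → Y) (hj : Continuous j) (hr : Set.range j = f ⁻¹' {ξ}) :
    ConnectedSpace Y := by
  have h1 : DenseRange j := fun y ↦ by
    obtain ⟨y', hy, hy'⟩ := hf (hξ (f y))
    exact hy.mem_closed isClosed_closure (subset_closure (hr ▸ hy' : y' ∈ Set.range j))
  have h2 : PreconnectedSpace Y := h1.preconnectedSpace hj
  obtain ⟨t⟩ : Nonempty T := inferInstance
  exact { toNonempty := ⟨j t⟩ }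

theorem connectedSpace_pullback_of_algebraicallyClosedIn [IsIntegral M] (h : M ⟶ X)
    {E : Type u} [Field E]
    [Algebra (X.residueField (h (genericPoint M))) E]
    [Algebra.IsAlgebraic (X.residueField (h (genericPoint M))) E]
    [CharZero (X.residueField (h (genericPoint M)))]
    [Flat (X.fromSpecResidueField (h (genericPoint M)))]
    (hcl : let _ := (h.residueFieldMap (genericPoint M)).hom.toAlgebra
      ∀ y : M.residueField (genericPoint M),
      IsIntegral (X.residueField (h (genericPoint M))) y → y ∈
      (algebraMap (X.residueField (h (genericPoint M))) (M.residueField (genericPoint M))).range) :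
    ConnectedSpace ↥(pullback h (Spec.map (CommRingCat.ofHom
      (algebraMap (X.residueField (h (genericPoint M))) E)) ≫
        X.fromSpecResidueField (h (genericPoint M)))) := by
  set K := X.residueField (h (genericPoint M))
  set L := M.residueField (genericPoint M)
  let _ : Algebra K L := (h.residueFieldMap (genericPoint M)).hom.toAlgebra
  have := isDomain_tensorProduct_of_algebraicallyClosedIn (E := E) hcl
  let j : pullback (Spec.map (CommRingCat.ofHom (algebraMap K L)))
      (Spec.map (CommRingCat.ofHom (algebraMap K E))) ⟶ pullback h (Spec.map (CommRingCat.ofHom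
      (algebraMap K E)) ≫ X.fromSpecResidueField (h (genericPoint M))) :=
    pullback.map _ _ _ _ (M.fromSpecResidueField _) (𝟙 _) (X.fromSpecResidueField _)
      (h.SpecMap_residueFieldMap_fromSpecResidueField _) (Category.id_comp _).symm
  have : Flat (Spec.map (CommRingCat.ofHom (algebraMap K E))) := by
    rw [Flat.SpecMap_iff]
    exact RingHom.flat_algebraMap_iff.2 inferInstance
  let e := pullbackSpecIso K L E
  have hr : Set.range (e.inv ≫ j) = pullback.fst h _ ⁻¹' {genericPoint M} := by
    rw [Scheme.Hom.comp_base, TopCat.coe_comp, Set.range_comp, e.inv.surjective.range_eq, Set.image_univ,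
      Scheme.Pullback.range_map, Scheme.range_fromSpecResidueField]
    simp
  exact connectedSpace_of_generalizingMap _ (Flat.generalizingMap _) (genericPoint M)
    genericPoint_specializes (e.inv ≫ j) (e.inv ≫ j).continuous hr
end


theorem charZero_residueField {k : Type u} [Field k] [CharZero k]
    (sX : X ⟶ Spec (CommRingCat.of k)) (x : X) : CharZero (X.residueField x) := by
  let φ := Spec.preimage (X.fromSpecResidueField x ≫ sX)
  exact charZero_of_injective_ringHom φ.hom.injective

/-- **Proposition 3.1 of the paper.**  Over an algebraically closed field `k` of
characteristic zero, let `h : M → X` be a projective morphism from a nonempty connected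
normal quasi-projective scheme `M` to a smooth quasi-projective integral scheme `X` which
is algebraically simply connected.  If the non-smooth locus of `h` has codimension at
least `2` in `M` (i.e. every irreducible closed subset contained in it has coheight at
least `2`), then the geometric generic fiber of `h` — the base change of `M` to the
spectrum of an algebraic closure of the function field `κ(η)` of `X` — is connected. -/
theorem stmt_0 (k : Type u) [Field k] [IsAlgClosed k] [CharZero k]
    (X M : Scheme.{u}) (sX : X ⟶ Spec (CommRingCat.of k))
    [IsIntegral X] (hXsm : IsSmooth sX) (hXqp : QuasiProjectiveOver k sX)
    (hXsc : AlgebraicallySimplyConnected X)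
    (hMne : Nonempty M) (hMconn : ConnectedSpace M) (hMnorm : IsNormalScheme M)
    (h : M ⟶ X) (hMqp : QuasiProjectiveOver k (h ≫ sX))
    (hproj : ProjectiveMorphismOver k sX h)
    (hcodim : ∀ T : IrreducibleCloseds M,
      (T : Set M) ⊆ {x : M | ¬ SmoothAtPoint h x} → 2 ≤ Order.coheight T) :
    ConnectedSpace
      ↥(pullback h
        ((Spec.map (CommRingCat.ofHom
            (algebraMap (X.residueField (genericPoint X))
              (AlgebraicClosure (X.residueField (genericPoint X))))) ≫
          X.fromSpecResidueField (genericPoint X) :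
          Spec (CommRingCat.of (AlgebraicClosure (X.residueField (genericPoint X)))) ⟶ X))) := by
  change Smooth sX at hXsm
  have := hMqp.isNoetherian
  have := isIntegral_of_connected_of_isDomain_stalk M fun x ↦ (hMnorm x).1
  have := hproj.isProper
  have hsm := smoothAtPoint_of_coheight_lt_two hcodim
  have hη : h (genericPoint M) = genericPoint X := by
    have h0 : Order.coheight (genericPoint M) = 0 := Order.coheight_eq_zero.mpr isMax_top
    exact (hsm _ (h0 ▸ zero_le_one)).map_genericPoint
  have hcl := isIntegral_mem_range_residueFieldMap sX hXsc (fun x ↦ (hMnorm x).2) h hsm hη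
  have : Flat (X.fromSpecResidueField (h (genericPoint M))) :=
    hη ▸ flat_fromSpecResidueField_genericPoint
  have := charZero_residueField sX (h (genericPoint M))
  have key : ∀ y, h (genericPoint M) = y → ConnectedSpace ↥(pullback h
      (Spec.map (CommRingCat.ofHom (algebraMap (X.residueField y)
        (AlgebraicClosure (X.residueField y)))) ≫ X.fromSpecResidueField y)) := by
    rintro _ rfl
    exact connectedSpace_pullback_of_algebraicallyClosedIn h hcl
  exact key _ hη

end
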